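/- Let n, p ≥ 1 and δ > 0. Every function f ∈ G^{1+δ}((ℝ^n)^p) invariant under the action of S_n × … × S_n (p factors) permuting the coordinates within each factor has the form f = F ∘ θ for some F ∈ G^{1+δn}((ℝ^n)^p). Moreover the exponent δn is minimal: for every γ with 0 < γ < δn there exists an invariant function f ∈ G^{1+δ}((ℝ^n)^p) such that no F ∈ G^{1+γ}((ℝ^n)^p) satisfies f = F ∘ θ. -/

import Mathlib

open scoped Nat ENNReal
open Matrix

/-- `f` belongs to the Denjoy–Carleman class `C^M` on the open set `U`. -/
def CMClassOn {E F : Type*} [NormedAddCommGroup E] [NormedSpace ℝ E]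
    [NormedAddCommGroup F] [NormedSpace ℝ F]
    (M : ℕ → ℝ) (U : Set E) (f : E → F) : Prop :=
  ContDiffOn ℝ (⊤ : ℕ∞) f U ∧
    ∀ K : Set E, K ⊆ U → IsCompact K →
      ∃ C > (0 : ℝ), ∃ ρ > (0 : ℝ), ∀ k : ℕ, ∀ x ∈ K,
        ‖iteratedFDerivWithin ℝ k f U x‖ ≤ C * ρ ^ k * (k ! : ℝ) * M k

/-- DC-weight sequence: `M 0 = 1`, positive, increasing, logarithmically convex,
and `sup_k (M (k+1) / M k) ^ (1/k) < ∞`. -/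
def DCWeightSeq (M : ℕ → ℝ) : Prop :=
  M 0 = 1 ∧ (∀ k, 0 < M k) ∧ (∀ k, M k ≤ M (k + 1)) ∧
    (∀ k : ℕ, 1 ≤ k → M k ^ 2 ≤ M (k - 1) * M (k + 1)) ∧
    ∃ C : ℝ, ∀ k : ℕ, 1 ≤ k → (M (k + 1) / M k) ^ ((1 : ℝ) / k) ≤ C

/-- Strong regularity: strong non-quasianalyticity together with moderate growth. -/
def StronglyRegular (N : ℕ → ℝ) : Prop :=
  (∃ C > (0 : ℝ), ∀ j : ℕ,
      ∑' k : ℕ, N (j + k) / (((j + k + 1 : ℕ) : ℝ) * N (j + k + 1)) ≤ C * (N j / N (j + 1))) ∧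
    ∃ C : ℝ, ∀ j k : ℕ, 1 ≤ j → 1 ≤ k →
      (N (j + k) / (N j * N k)) ^ ((1 : ℝ) / ((j : ℝ) + (k : ℝ))) ≤ C

/-- The map `θ = (σ, …, σ) : (ℝⁿ)^p → (ℝⁿ)^p`, where `σ = (σ₁, …, σₙ)` consists of the
elementary symmetric polynomials, applied in each factor. -/
def theta (n p : ℕ) (x : Fin p → Fin n → ℝ) : Fin p → Fin n → ℝ :=
  fun j i => ∑ t ∈ Finset.univ.powersetCard (i.1 + 1), ∏ r ∈ t, x j r

section GevreyBounds

variable {E F : Type*} [NormedAddCommGroup E] [NormedSpace ℝ E]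
  [NormedAddCommGroup F] [NormedSpace ℝ F]

/-- The derivatives of `f` at `x` satisfy Gevrey estimates of order `s` with constants `C`, `ρ`. -/
def GevreyBoundAt (s C ρ : ℝ) (f : E → F) (x : E) : Prop :=
  ∀ k : ℕ, ‖iteratedFDeriv ℝ k f x‖ ≤ C * ρ ^ k * (k ! : ℝ) ^ s

theorem GevreyBoundAt.mono {s C ρ C' ρ' : ℝ} {f : E → F} {x : E}
    (h : GevreyBoundAt s C ρ f x) (hC : 0 ≤ C) (hρ : 0 ≤ ρ) (hC' : C ≤ C') (hρ' : ρ ≤ ρ') :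
    GevreyBoundAt s C' ρ' f x := fun k =>
  (h k).trans (by have := hC.trans hC'; gcongr)

theorem GevreyBoundAt.congr {s C ρ : ℝ} {f g : E → F} {x : E}
    (h : GevreyBoundAt s C ρ f x) (hfg : f =ᶠ[nhds x] g) : GevreyBoundAt s C ρ g x := fun k => by
  rw [← (hfg.iteratedFDeriv ℝ k).eq_of_nhds]; exact h k

theorem GevreyBoundAt.zero (s C ρ : ℝ) (hC : 0 ≤ C) (hρ : 0 ≤ ρ) (x : E) :
    GevreyBoundAt s C ρ (fun _ : E => (0 : F)) x := fun k => by
  rw [iteratedFDeriv_fun_zero]; simp only [Pi.zero_apply, norm_zero]; positivity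

theorem GevreyBoundAt.add {s C₁ C₂ ρ : ℝ} {f g : E → F} {x : E}
    (hf : GevreyBoundAt s C₁ ρ f x) (hg : GevreyBoundAt s C₂ ρ g x)
    (hf' : ContDiff ℝ (⊤ : ℕ∞) f) (hg' : ContDiff ℝ (⊤ : ℕ∞) g) :
    GevreyBoundAt s (C₁ + C₂) ρ (fun y => f y + g y) x := fun k => by
  rw [fun_iteratedFDeriv_add_apply (i := k) (hf'.of_le (by exact_mod_cast le_top)).contDiffAt
    (hg'.of_le (by exact_mod_cast le_top)).contDiffAt]
  refine (norm_add_le _ _).trans ?_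
  have := hf k; have := hg k
  nlinarith

theorem factorial_rpow_mul_le {s : ℝ} (hs : 0 ≤ s) {k i : ℕ} (hi : i ≤ k) :
    ((i ! : ℝ) ^ s) * (((k - i)! : ℕ) : ℝ) ^ s ≤ (k ! : ℝ) ^ s := by
  rw [← Real.mul_rpow (by positivity) (by positivity)]
  apply Real.rpow_le_rpow (by positivity) _ hs
  exact_mod_cast Nat.le_of_dvd (Nat.factorial_pos k) (Nat.factorial_mul_factorial_dvd_factorial hi)

theorem GevreyBoundAt.smul {𝕜 : Type*} [NormedField 𝕜] [NormedAlgebra ℝ 𝕜] [NormedSpace 𝕜 F]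
    [IsScalarTower ℝ 𝕜 F] {s C₁ C₂ ρ₁ ρ₂ : ℝ} (hs : 0 ≤ s) {f : E → 𝕜} {g : E → F} {x : E}
    (hf : GevreyBoundAt s C₁ ρ₁ f x) (hg : GevreyBoundAt s C₂ ρ₂ g x)
    (hC₁ : 0 ≤ C₁) (hC₂ : 0 ≤ C₂) (hρ₁ : 0 ≤ ρ₁) (hρ₂ : 0 ≤ ρ₂)
    (hf' : ContDiff ℝ (⊤ : ℕ∞) f) (hg' : ContDiff ℝ (⊤ : ℕ∞) g) :
    GevreyBoundAt s (C₁ * C₂) (ρ₁ + ρ₂) (fun y => f y • g y) x := fun k => by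
  refine (norm_iteratedFDeriv_smul_le hf' hg' x (n := k) (by exact_mod_cast le_top)).trans ?_
  rw [add_pow, Finset.mul_sum, Finset.sum_mul]
  refine Finset.sum_le_sum fun i hi => ?_
  have hi : i ≤ k := by simpa [Nat.lt_succ_iff] using hi
  calc _ ≤ (k.choose i : ℝ) * (C₁ * ρ₁ ^ i * (i ! : ℝ) ^ s) *
        (C₂ * ρ₂ ^ (k - i) * ((k - i)! : ℝ) ^ s) := by
        gcongr
        · exact hf i
        · exact hg (k - i)
    _ = C₁ * C₂ * (ρ₁ ^ i * ρ₂ ^ (k - i) * k.choose i) *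
        ((i ! : ℝ) ^ s * ((k - i)! : ℝ) ^ s) := by ring
    _ ≤ _ := by
        gcongr
        exact factorial_rpow_mul_le hs hi

theorem GevreyBoundAt.mul {𝕜 : Type*} [NormedField 𝕜] [NormedAlgebra ℝ 𝕜]
    {s C₁ C₂ ρ₁ ρ₂ : ℝ} (hs : 0 ≤ s) {f g : E → 𝕜} {x : E}
    (hf : GevreyBoundAt s C₁ ρ₁ f x) (hg : GevreyBoundAt s C₂ ρ₂ g x)
    (hC₁ : 0 ≤ C₁) (hC₂ : 0 ≤ C₂) (hρ₁ : 0 ≤ ρ₁) (hρ₂ : 0 ≤ ρ₂)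
    (hf' : ContDiff ℝ (⊤ : ℕ∞) f) (hg' : ContDiff ℝ (⊤ : ℕ∞) g) :
    GevreyBoundAt s (C₁ * C₂) (ρ₁ + ρ₂) (fun y => f y * g y) x :=
  hf.smul hs hg hC₁ hC₂ hρ₁ hρ₂ hf' hg'

theorem GevreyBoundAt.prod {𝕜 ι : Type*} [NormedField 𝕜] [NormedAlgebra ℝ 𝕜]
    {s C ρ : ℝ} (hs : 0 ≤ s) (hC : 0 ≤ C) (hρ : 0 ≤ ρ) (t : Finset ι) {f : ι → E → 𝕜} {x : E}
    (hf : ∀ i ∈ t, GevreyBoundAt s C ρ (f i) x) (hf' : ∀ i ∈ t, ContDiff ℝ (⊤ : ℕ∞) (f i)) :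
    GevreyBoundAt s (C ^ t.card) (t.card * ρ) (fun y => ∏ i ∈ t, f i y) x := by
  classical
  induction t using Finset.induction_on with
  | empty =>
    intro k
    rcases Nat.eq_zero_or_pos k with rfl | hk
    · simp
    · simp only [Finset.prod_empty]
      rw [iteratedFDeriv_const_of_ne hk.ne' _]
      simp [hk.ne']
  | insert a t ha ih =>
    have h1 := ih (fun i hi => hf i (Finset.mem_insert_of_mem hi))
      (fun i hi => hf' i (Finset.mem_insert_of_mem hi))
    have h2 := (hf a (Finset.mem_insert_self _ _)).mul hs h1 hC (by positivity) hρ (by positivity)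
      (hf' a (Finset.mem_insert_self _ _))
      (contDiff_prod fun i hi => hf' i (Finset.mem_insert_of_mem hi))
    simp only [Finset.prod_insert ha, Finset.card_insert_of_notMem ha]
    convert h2 using 1
    · ring
    · push_cast; ring

theorem GevreyBoundAt.comp_clm {G : Type*} [NormedAddCommGroup G] [NormedSpace ℝ G]
    {s C ρ : ℝ} {f : E → F} (L : G →L[ℝ] E) {x : G}
    (hf : GevreyBoundAt s C ρ f (L x)) (hf' : ContDiff ℝ (⊤ : ℕ∞) f) :
    GevreyBoundAt s C (ρ * ‖L‖) (fun y => f (L y)) x := fun k => by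
  have h := L.iteratedFDeriv_comp_right hf' x (i := k) (by exact_mod_cast le_top)
  rw [show (fun y => f (L y)) = f ∘ L from rfl, h]
  refine (ContinuousMultilinearMap.norm_compContinuousLinearMap_le _ _).trans ?_
  rw [Finset.prod_const, Finset.card_univ, Fintype.card_fin, mul_pow]
  have := hf k
  calc _ ≤ (C * ρ ^ k * (k ! : ℝ) ^ s) * ‖L‖ ^ k := by gcongr
    _ = _ := by ring

theorem GevreyBoundAt.comp_add {s C ρ : ℝ} {f : E → F} {a x : E}
    (hf : GevreyBoundAt s C ρ f (x + a)) : GevreyBoundAt s C ρ (fun y => f (y + a)) x := fun k => by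
  rw [iteratedFDeriv_comp_add_right]; exact hf k

theorem GevreyBoundAt.clm_comp {G : Type*} [NormedAddCommGroup G] [NormedSpace ℝ G]
    {s C ρ : ℝ} {f : E → F} (L : F →L[ℝ] G) {x : E}
    (hf : GevreyBoundAt s C ρ f x) (hf' : ContDiff ℝ (⊤ : ℕ∞) f) :
    GevreyBoundAt s (‖L‖ * C) ρ (fun y => L (f y)) x := fun k => by
  have h := L.norm_iteratedFDeriv_comp_left (f := f) (x := x) (N := (⊤ : ℕ∞)) (n := k)
    hf'.contDiffAt (by exact_mod_cast le_top)
  refine (h.trans (mul_le_mul_of_nonneg_left (hf k) (norm_nonneg _))).trans (le_of_eq (by ring))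

theorem cmClassOn_univ_iff {δ : ℝ} (f : E → F) :
    CMClassOn (fun k => (k ! : ℝ) ^ δ) Set.univ f ↔
      ContDiff ℝ (⊤ : ℕ∞) f ∧ ∀ K : Set E, IsCompact K →
        ∃ C > (0 : ℝ), ∃ ρ > (0 : ℝ), ∀ x ∈ K, GevreyBoundAt (1 + δ) C ρ f x := by
  have key : ∀ k : ℕ, (k ! : ℝ) ^ (1 + δ) = (k ! : ℝ) * (k ! : ℝ) ^ δ := fun k => by
    rw [Real.rpow_add (by positivity), Real.rpow_one]
  simp only [CMClassOn, contDiffOn_univ, iteratedFDerivWithin_univ, GevreyBoundAt, key,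
    Set.subset_univ, true_implies, ← mul_assoc]
  refine and_congr_right fun _ => forall_congr' fun K => imp_congr_right fun _ => ?_
  refine exists_congr fun C => and_congr_right fun _ => exists_congr fun ρ =>
      and_congr_right fun _ => ?_
  exact ⟨fun h x hx k => h k x hx, fun h k x hx => h x hx k⟩

theorem pow_le_factorial_mul_exp {η u : ℝ} (hη : 0 < η) (hu : 0 ≤ u) (k : ℕ) :
    u ^ k ≤ (k ! : ℝ) * η⁻¹ ^ k * Real.exp (η * u) := by
  have h := Real.pow_div_factorial_le_exp (η * u) (by positivity) k
  rw [div_le_iff₀ (by positivity), mul_pow] at h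
  rw [inv_pow]
  have : u ^ k = (η ^ k)⁻¹ * (η ^ k * u ^ k) := by field_simp
  rw [this]
  calc _ ≤ (η ^ k)⁻¹ * (Real.exp (η * u) * k !) := by gcongr
    _ = _ := by ring

end GevreyBounds

section FlatExp

theorem exists_half_le_re_cpow (α : ℝ) :
    ∃ θ : ℝ, 0 < θ ∧ θ < 1 ∧ ∀ w : ℂ, ‖w - 1‖ ≤ θ → 1 / 2 ≤ (w ^ (-α : ℂ)).re := by
  have hc : ContinuousAt (fun w : ℂ => (w ^ (-α : ℂ)).re) 1 :=
    Complex.continuous_re.continuousAt.comp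
      (continuousAt_id.cpow continuousAt_const (by simp [Complex.one_mem_slitPlane]))
  have h := hc.eventually (lt_mem_nhds (a := 1 / 2) (by norm_num))
  obtain ⟨ε, hε, h⟩ := Metric.eventually_nhds_iff.1 h
  refine ⟨min (ε / 2) (1 / 2), by positivity, by
    exact (min_le_right _ _).trans_lt (by norm_num), fun w hw => ?_⟩
  refine (h ?_).le
  rw [dist_eq_norm]
  have := hw.trans (min_le_left _ _)
  linarith

theorem half_mul_rpow_le_re_cpow {α θ : ℝ} (hθ : 0 < θ) (hθ1 : θ < 1)
    (h : ∀ w : ℂ, ‖w - 1‖ ≤ θ → 1 / 2 ≤ (w ^ (-α : ℂ)).re) {x : ℝ} (hx : 0 < x) {z : ℂ}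
    (hz : ‖z - x‖ ≤ θ * x) : z ∈ Complex.slitPlane ∧ x ^ (-α) / 2 ≤ (z ^ (-α : ℂ)).re := by
  have hx' : (x : ℂ) ≠ 0 := by exact_mod_cast hx.ne'
  set w : ℂ := z / x with hw
  have hzw : z = x * w := by rw [hw]; field_simp
  have hw1 : ‖w - 1‖ ≤ θ := by
    have : w - 1 = (z - x) / x := by rw [hw]; field_simp
    rw [this, norm_div, Complex.norm_real, Real.norm_of_nonneg hx.le, div_le_iff₀ hx]
    exact hz
  have hz0 : z ∈ Complex.slitPlane := by
    left
    have := (Complex.abs_re_le_norm (z - x)).trans hz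
    rw [Complex.sub_re, Complex.ofReal_re] at this
    have := (abs_le.1 this).1
    nlinarith
  refine ⟨hz0, ?_⟩
  have hz1 : z ≠ 0 := Complex.slitPlane_ne_zero hz0
  have hw0 : w ≠ 0 := by rintro h0; rw [h0, mul_zero] at hzw; exact hz1 hzw
  have : z ^ (-α : ℂ) = ((x ^ (-α) : ℝ) : ℂ) * w ^ (-α : ℂ) := by
    rw [Complex.cpow_def_of_ne_zero hz1, Complex.cpow_def_of_ne_zero hw0, hzw,
      Complex.log_ofReal_mul hx hw0, add_mul, Complex.exp_add, Real.rpow_def_of_pos hx]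
    push_cast
    rfl
  rw [this, Complex.re_ofReal_mul]
  have := h w hw1
  have := Real.rpow_pos_of_pos hx (-α)
  nlinarith

/-- The holomorphic function `z ↦ exp (-κ z ^ (-α))`. -/
noncomputable def cflat (κ α : ℝ) (z : ℂ) : ℂ := Complex.exp (-κ * z ^ (-α : ℂ))

/-- The `k`-th derivative of the flat function `exp (-κ x ^ (-α))`, extended by zero. -/
noncomputable def flatDeriv (κ α : ℝ) (k : ℕ) (x : ℝ) : ℝ :=
  if 0 < x then (iteratedDeriv k (cflat κ α) x).re else 0

theorem cflat_differentiableOn (κ α : ℝ) :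
    DifferentiableOn ℂ (cflat κ α) Complex.slitPlane := fun z hz => by
  have : DifferentiableAt ℂ (fun z : ℂ => z ^ (-α : ℂ)) z :=
    differentiableAt_id.cpow_const hz
  exact ((this.const_mul (-κ : ℂ)).cexp).differentiableWithinAt

theorem rpow_neg_mul_exp_le {κ α : ℝ} (hκ : 0 < κ) (hα : 0 < α) {x : ℝ} (hx : 0 < x) (k : ℕ) :
    (x ^ k)⁻¹ * Real.exp (-κ * (x ^ (-α) / 2)) ≤
      ((2 / (α * κ)) ^ (1 / α)) ^ k * (k ! : ℝ) ^ (1 / α) := by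
  set u := x ^ (-α) with hu
  have hu0 : 0 < u := Real.rpow_pos_of_pos hx _
  have h1 := pow_le_factorial_mul_exp (η := α * κ / 2) (by positivity) hu0.le k
  have h2 : u ^ k * Real.exp (-(α * κ / 2 * u)) ≤ (k ! : ℝ) * (2 / (α * κ)) ^ k := by
    rw [Real.exp_neg, ← div_eq_mul_inv, div_le_iff₀ (Real.exp_pos _)]
    rwa [inv_div] at h1
  have h3 := Real.rpow_le_rpow (by positivity) h2 (by positivity : 0 ≤ 1 / α)
  rw [Real.mul_rpow (by positivity) (by positivity), Real.mul_rpow (by positivity) (by positivity)]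
    at h3
  have e1 : (u ^ k) ^ (1 / α) = (x ^ k)⁻¹ := by
    rw [hu, ← Real.rpow_natCast, ← Real.rpow_mul hx.le, ← Real.rpow_mul hx.le,
      ← Real.rpow_natCast x k, ← Real.rpow_neg hx.le]
    congr 1; field_simp
  have e2 : Real.exp (-(α * κ / 2 * u)) ^ (1 / α) = Real.exp (-κ * (u / 2)) := by
    rw [← Real.exp_mul]; congr 1; field_simp
  have e3 : ((2 / (α * κ)) ^ k) ^ (1 / α) = ((2 / (α * κ)) ^ (1 / α)) ^ k := by
    rw [← Real.rpow_natCast, ← Real.rpow_natCast, ← Real.rpow_mul (by positivity),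
      ← Real.rpow_mul (by positivity), mul_comm (k : ℝ)]
  rw [e1, e2, e3] at h3
  linarith

theorem exists_flatDeriv_bound {κ α : ℝ} (hκ : 0 < κ) :
    ∃ A : ℝ, 0 < A ∧ ∀ (k : ℕ) (x : ℝ), 0 < x →
      |flatDeriv κ α k x| ≤ (k ! : ℝ) * A ^ k * ((x ^ k)⁻¹ * Real.exp (-κ * (x ^ (-α) / 2))) := by
  obtain ⟨θ, hθ, hθ1, h⟩ := exists_half_le_re_cpow α
  refine ⟨θ⁻¹, by positivity, fun k x hx => ?_⟩
  rw [flatDeriv, if_pos hx]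
  refine (Complex.abs_re_le_norm _).trans ?_
  have hsub : Metric.closedBall (x : ℂ) (θ * x) ⊆ Complex.slitPlane := fun z hz =>
    (half_mul_rpow_le_re_cpow hθ hθ1 h hx (by rwa [← dist_eq_norm])).1
  have hd : DiffContOnCl ℂ (cflat κ α) (Metric.ball (x : ℂ) (θ * x)) := by
    apply DifferentiableOn.diffContOnCl
    exact (cflat_differentiableOn κ α).mono (Metric.closure_ball_subset_closedBall.trans hsub)
  refine (Complex.norm_iteratedDeriv_le_of_forall_mem_sphere_norm_le k (by positivity) hd
    (C := Real.exp (-κ * (x ^ (-α) / 2))) ?_).trans (le_of_eq ?_)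
  · intro z hz
    have := (half_mul_rpow_le_re_cpow hθ hθ1 h hx (z := z)
      (by rw [← dist_eq_norm]; exact (Metric.mem_sphere.1 hz).le)).2
    rw [cflat, Complex.norm_exp]
    apply Real.exp_le_exp.2
    rw [← Complex.ofReal_neg, Complex.re_ofReal_mul]
    nlinarith
  · rw [mul_pow, inv_pow]; field_simp

theorem hasDerivAt_flatDeriv {κ α : ℝ} (hκ : 0 < κ) (hα : 0 < α) (k : ℕ) (x : ℝ) :
    HasDerivAt (flatDeriv κ α k) (flatDeriv κ α (k + 1) x) x := by
  rcases lt_trichotomy x 0 with hx | rfl | hx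
  · have : flatDeriv κ α k =ᶠ[nhds x] fun _ => 0 := by
      filter_upwards [Iio_mem_nhds hx] with y hy
      rw [flatDeriv, if_neg (not_lt.2 (le_of_lt hy))]
    rw [flatDeriv, if_neg (not_lt.2 hx.le)]
    exact (hasDerivAt_const x (0 : ℝ)).congr_of_eventuallyEq this
  · obtain ⟨A, hA, hb⟩ := exists_flatDeriv_bound hκ
    set B := (k ! : ℝ) * A ^ k * (((2 / (α * κ)) ^ (1 / α)) ^ (k + 2) * ((k + 2)! : ℝ) ^ (1 / α))
    have hB : ∀ y : ℝ, |flatDeriv κ α k y| ≤ B * y ^ 2 := by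
      intro y
      by_cases hy : 0 < y
      · refine (hb k y hy).trans ?_
        have h1 := rpow_neg_mul_exp_le hκ hα hy (k + 2)
        have h2 : (y ^ k)⁻¹ * Real.exp (-κ * (y ^ (-α) / 2)) ≤
            (((2 / (α * κ)) ^ (1 / α)) ^ (k + 2) * ((k + 2)! : ℝ) ^ (1 / α)) * y ^ 2 := by
          rw [pow_add y, mul_inv] at h1
          calc _ = ((y ^ k)⁻¹ * (y ^ 2)⁻¹ * Real.exp (-κ * (y ^ (-α) / 2))) * y ^ 2 := by
                field_simp
            _ ≤ _ := by gcongr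
        calc _ ≤ (k ! : ℝ) * A ^ k * ((((2 / (α * κ)) ^ (1 / α)) ^ (k + 2) *
              ((k + 2)! : ℝ) ^ (1 / α)) * y ^ 2) := by gcongr
          _ = _ := by ring
      · rw [flatDeriv, if_neg hy, abs_zero]; positivity
    rw [hasDerivAt_iff_isLittleO_nhds_zero]
    have h0 : ∀ j, flatDeriv κ α j 0 = 0 := fun j => by simp [flatDeriv]
    simp only [zero_add, h0, sub_zero, smul_zero]
    have : (fun h : ℝ => flatDeriv κ α k h) =O[nhds 0] fun h => h ^ 2 :=
      Asymptotics.IsBigO.of_bound B (Filter.Eventually.of_forall fun y => by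
        rw [Real.norm_eq_abs, Real.norm_of_nonneg (sq_nonneg y)]; exact hB y)
    refine this.trans_isLittleO ?_
    simpa using Asymptotics.isLittleO_pow_pow (𝕜 := ℝ) (m := 1) (n := 2) (by norm_num)
  · have hsl : (x : ℂ) ∈ Complex.slitPlane := Or.inl (by simpa using hx)
    have han : AnalyticAt ℂ (iteratedDeriv k (cflat κ α)) x := by
      have : AnalyticAt ℂ (cflat κ α) x :=
        (cflat_differentiableOn κ α).analyticAt (Complex.isOpen_slitPlane.mem_nhds hsl)
      rw [iteratedDeriv_eq_iterate]
      exact this.iterated_deriv k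
    have hd := han.differentiableAt.hasDerivAt.real_of_complex
    rw [← iteratedDeriv_succ] at hd
    have : flatDeriv κ α k =ᶠ[nhds x] fun y : ℝ => (iteratedDeriv k (cflat κ α) y).re := by
      filter_upwards [Ioi_mem_nhds hx] with y hy
      rw [flatDeriv, if_pos (Set.mem_Ioi.1 hy)]
    have e : flatDeriv κ α (k + 1) x = (iteratedDeriv (k + 1) (cflat κ α) x).re := by
      rw [flatDeriv, if_pos hx]
    rw [e]
    exact hd.congr_of_eventuallyEq this

/-- The flat function `exp (-κ x ^ (-α))` on the positive reals, extended by zero. -/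
noncomputable def flatExp (κ α x : ℝ) : ℝ := if 0 < x then Real.exp (-κ * x ^ (-α)) else 0

theorem iteratedDeriv_flatExp {κ α : ℝ} (hκ : 0 < κ) (hα : 0 < α) (k : ℕ) :
    iteratedDeriv k (flatExp κ α) = flatDeriv κ α k := by
  induction k with
  | zero =>
    ext x
    rw [iteratedDeriv_zero, flatExp, flatDeriv]
    split_ifs with hx
    · rw [iteratedDeriv_zero, cflat, ← Complex.ofReal_neg, ← Complex.ofReal_neg,
        ← Complex.ofReal_cpow hx.le, ← Complex.ofReal_mul, ← Complex.ofReal_exp, Complex.ofReal_re]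
    · rfl
  | succ k ih =>
    rw [iteratedDeriv_succ, ih]
    ext x
    exact (hasDerivAt_flatDeriv hκ hα k x).deriv

theorem contDiff_flatExp {κ α : ℝ} (hκ : 0 < κ) (hα : 0 < α) :
    ContDiff ℝ (⊤ : ℕ∞) (flatExp κ α) := by
  apply contDiff_of_differentiable_iteratedDeriv
  intro m _
  rw [iteratedDeriv_flatExp hκ hα]
  exact fun x => (hasDerivAt_flatDeriv hκ hα m x).differentiableAt

theorem exists_flatExp_gevreyBound {κ α : ℝ} (hκ : 0 < κ) (hα : 0 < α) :
    ∃ ρ : ℝ, 0 < ρ ∧ ∀ x, GevreyBoundAt (1 + 1 / α) 1 ρ (flatExp κ α) x := by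
  obtain ⟨A, hA, hb⟩ := exists_flatDeriv_bound hκ
  refine ⟨A * (2 / (α * κ)) ^ (1 / α), by positivity, fun x k => ?_⟩
  rw [norm_iteratedFDeriv_eq_norm_iteratedDeriv, iteratedDeriv_flatExp hκ hα, Real.norm_eq_abs]
  by_cases hx : 0 < x
  · refine (hb k x hx).trans ?_
    have h1 := rpow_neg_mul_exp_le hκ hα hx k
    calc _ ≤ (k ! : ℝ) * A ^ k * (((2 / (α * κ)) ^ (1 / α)) ^ k * (k ! : ℝ) ^ (1 / α)) := by gcongr
      _ = _ := by
        rw [Real.rpow_add (by positivity), Real.rpow_one, mul_pow]; ring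
  · rw [flatDeriv, if_neg hx, abs_zero]; positivity

theorem flatExp_nonneg (κ α x : ℝ) : 0 ≤ flatExp κ α x := by
  rw [flatExp]; split_ifs <;> positivity

theorem flatExp_of_nonpos (κ α : ℝ) {x : ℝ} (hx : x ≤ 0) : flatExp κ α x = 0 :=
  if_neg (not_lt.2 hx)

theorem le_flatExp {κ α r x : ℝ} (hκ : 0 < κ) (hα : 0 < α) (hr : 0 < r) (hx : r ≤ x) :
    Real.exp (-κ * r ^ (-α)) ≤ flatExp κ α x := by
  rw [flatExp, if_pos (hr.trans_le hx)]
  apply Real.exp_le_exp.2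
  have := Real.rpow_le_rpow_of_nonpos hr hx (neg_nonpos.2 hα.le)
  nlinarith

end FlatExp

section Cutoff

open MeasureTheory Convolution

variable {E : Type} [NormedAddCommGroup E] [NormedSpace ℝ E] [FiniteDimensional ℝ E]
  [MeasurableSpace E] [BorelSpace E] (μ : Measure E) [μ.IsAddHaarMeasure]

theorem norm_iteratedFDeriv_indicator_convolution_le {V : Set E} (hV : MeasurableSet V) (k : ℕ)
    {G : Type} [NormedAddCommGroup G] [NormedSpace ℝ G] [CompleteSpace G] {g : E → G}
    (hg : ContDiff ℝ (⊤ : ℕ∞) g) (hs : Function.support g ⊆ Metric.closedBall 0 1) {M : ℝ}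
    (hM : ∀ x, ‖iteratedFDeriv ℝ k g x‖ ≤ M) (x : E) :
    ‖iteratedFDeriv ℝ k (V.indicator (fun _ => (1 : ℝ)) ⋆[ContinuousLinearMap.lsmul ℝ ℝ, μ] g) x‖
      ≤ M * μ.real (Metric.closedBall 0 1) := by
  have hM0 : 0 ≤ M := (norm_nonneg _).trans (hM 0)
  have htop : μ (Metric.closedBall (0 : E) 1) < ⊤ := measure_closedBall_lt_top
  induction k generalizing G x with
  | zero =>
    simp only [norm_iteratedFDeriv_zero] at hM ⊢
    rw [convolution_def]
    have hsupp : ∀ t, t ∉ Metric.closedBall x 1 →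
        ContinuousLinearMap.lsmul ℝ ℝ (V.indicator (fun _ => (1 : ℝ)) t) (g (x - t)) = 0 := by
      intro t ht
      have : g (x - t) = 0 := by
        by_contra h
        have h1 := hs h
        rw [mem_closedBall_zero_iff, ← dist_eq_norm, dist_comm] at h1
        exact ht h1
      rw [this, map_zero]
    rw [← setIntegral_eq_integral_of_forall_compl_eq_zero (s := Metric.closedBall x 1) hsupp]
    refine (norm_setIntegral_le_of_norm_le_const (C := M) measure_closedBall_lt_top ?_).trans ?_
    · intro t _
      rw [ContinuousLinearMap.lsmul_apply, norm_smul]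
      by_cases ht : t ∈ V
      · rw [Set.indicator_of_mem ht, norm_one, one_mul]; exact hM _
      · rw [Set.indicator_of_notMem ht, norm_zero, zero_mul]; exact hM0
    · rw [Measure.real, Measure.real, Measure.addHaar_closedBall_center]
  | succ k ih =>
    have hcs : HasCompactSupport g :=
      HasCompactSupport.intro (isCompact_closedBall (0 : E) 1) fun y hy => by
        by_contra h; exact hy (hs h)
    have hloc : LocallyIntegrable (V.indicator (fun _ => (1 : ℝ))) μ :=
      (locallyIntegrable_const 1).indicator hV
    have hL : (ContinuousLinearMap.lsmul ℝ ℝ : ℝ →L[ℝ] G →L[ℝ] G).precompR E =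
        ContinuousLinearMap.lsmul ℝ ℝ := by
      ext; simp [ContinuousLinearMap.precompR_apply]
    have hd : fderiv ℝ (V.indicator (fun _ => (1 : ℝ)) ⋆[ContinuousLinearMap.lsmul ℝ ℝ, μ] g) =
        V.indicator (fun _ => (1 : ℝ)) ⋆[ContinuousLinearMap.lsmul ℝ ℝ, μ] fderiv ℝ g := by
      ext1 y
      rw [(hcs.hasFDerivAt_convolution_right _ hloc (hg.of_le (by exact_mod_cast le_top)) y).fderiv,
        hL]
    rw [← norm_iteratedFDeriv_fderiv, hd]
    refine ih (hg.fderiv_right (m := (⊤ : ℕ∞)) (by exact_mod_cast le_top)) ?_ (fun y => ?_) x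
    · refine (subset_closure.trans (tsupport_fderiv_subset ℝ)).trans ?_
      exact closure_minimal hs Metric.isClosed_closedBall
    · rw [norm_iteratedFDeriv_fderiv]; exact hM y

theorem exists_cutoff_of_kernel {s C ρ r : ℝ} (hr1 : r ≤ 1)
    {g : E → ℝ} (hg : ContDiff ℝ (⊤ : ℕ∞) g) (hs : ∀ x, g x ≠ 0 → ‖x‖ < r)
    (hI : 0 < ∫ x, g x ∂μ) (hgb : ∀ x, GevreyBoundAt s C ρ g x) (A : Set E) :
    ∃ χ : E → ℝ, ContDiff ℝ (⊤ : ℕ∞) χ ∧ (∀ x ∈ A, χ x = 1) ∧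
      (∀ x, (∀ a ∈ A, 2 * r ≤ dist x a) → χ x = 0) ∧
      ∀ x, GevreyBoundAt s ((∫ x, g x ∂μ)⁻¹ * (C * μ.real (Metric.closedBall 0 1))) ρ χ x := by
  set V := Metric.thickening r A with hVdef
  have hV : MeasurableSet V := Metric.isOpen_thickening.measurableSet
  set I := ∫ x, g x ∂μ
  set u := V.indicator (fun _ => (1 : ℝ)) ⋆[ContinuousLinearMap.lsmul ℝ ℝ, μ] g with hu
  have hsupp : Function.support g ⊆ Metric.closedBall 0 1 := fun x hx => by
    rw [mem_closedBall_zero_iff]; exact (hs x hx).le.trans hr1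
  have hcs : HasCompactSupport g :=
    HasCompactSupport.intro (isCompact_closedBall (0 : E) 1) fun y hy => by
      by_contra h; exact hy (hsupp h)
  have hloc : LocallyIntegrable (V.indicator (fun _ => (1 : ℝ))) μ :=
    (locallyIntegrable_const 1).indicator hV
  have hud : ContDiff ℝ (⊤ : ℕ∞) u := hcs.contDiff_convolution_right _ hloc hg
  refine ⟨fun x => I⁻¹ • u x, hud.const_smul _, fun x hx => ?_, fun x hx => ?_, fun x k => ?_⟩
  · have : u x = I := by
      rw [hu, convolution_def]
      have : ∀ t, ContinuousLinearMap.lsmul ℝ ℝ (V.indicator (fun _ => (1 : ℝ)) t) (g (x - t)) =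
          g (x - t) := by
        intro t
        by_cases h : g (x - t) = 0
        · rw [h, map_zero]
        · have ht : t ∈ V := Metric.mem_thickening_iff.2 ⟨x, hx, by
            rw [dist_comm, dist_eq_norm]; exact hs _ h⟩
          rw [Set.indicator_of_mem ht]; simp
      simp_rw [this]
      exact integral_sub_left_eq_self g μ x
    show I⁻¹ • u x = 1
    rw [this, smul_eq_mul, inv_mul_cancel₀ hI.ne']
  · have : u x = 0 := by
      rw [hu, convolution_def]
      have : ∀ t, ContinuousLinearMap.lsmul ℝ ℝ (V.indicator (fun _ => (1 : ℝ)) t) (g (x - t)) =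
          0 := by
        intro t
        by_cases h : g (x - t) = 0
        · rw [h, map_zero]
        · have ht : t ∉ V := fun ht => by
            obtain ⟨a, ha, hta⟩ := Metric.mem_thickening_iff.1 ht
            have h1 := hs _ h
            rw [← dist_eq_norm] at h1
            linarith [hx a ha, dist_triangle x t a]
          rw [Set.indicator_of_notMem ht]; simp
      simp_rw [this, integral_zero]
    show I⁻¹ • u x = 0
    rw [this, smul_zero]
  · rw [iteratedFDeriv_const_smul_apply' (hud.of_le (by exact_mod_cast le_top)).contDiffAt,
      norm_smul, norm_inv, Real.norm_of_nonneg hI.le]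
    calc _ ≤ I⁻¹ * (C * ρ ^ k * (k ! : ℝ) ^ s * μ.real (Metric.closedBall 0 1)) := by
          gcongr
          exact norm_iteratedFDeriv_indicator_convolution_le μ hV k hg hsupp (fun y => hgb y k) x
      _ = _ := by ring

/-- The coordinate functional `x ↦ x q.1 q.2`. -/
noncomputable def coordCLM (n p : ℕ) (q : Fin p × Fin n) : (Fin p → Fin n → ℝ) →L[ℝ] ℝ :=
  (ContinuousLinearMap.proj q.2 : (Fin n → ℝ) →L[ℝ] ℝ).comp
    (ContinuousLinearMap.proj q.1 : (Fin p → Fin n → ℝ) →L[ℝ] (Fin n → ℝ))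

theorem coordCLM_apply (n p : ℕ) (q : Fin p × Fin n) (x : Fin p → Fin n → ℝ) :
    coordCLM n p q x = x q.1 q.2 := rfl

theorem norm_coordCLM_le (n p : ℕ) (q : Fin p × Fin n) : ‖coordCLM n p q‖ ≤ 1 :=
  ContinuousLinearMap.opNorm_le_bound _ zero_le_one fun x => by
    rw [one_mul, coordCLM_apply]
    exact (norm_le_pi_norm (x q.1) q.2).trans (norm_le_pi_norm x q.1)

/-- A product kernel supported in the ball of radius `r`. -/
noncomputable def boxKernel (n p : ℕ) (κ α r : ℝ) (x : Fin p → Fin n → ℝ) : ℝ :=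
  ∏ q : Fin p × Fin n, flatExp κ α (r + x q.1 q.2) * flatExp κ α (r - x q.1 q.2)

theorem contDiff_boxKernel (n p : ℕ) {κ α : ℝ} (hκ : 0 < κ) (hα : 0 < α) (r : ℝ) :
    ContDiff ℝ (⊤ : ℕ∞) (boxKernel n p κ α r) := by
  have := contDiff_flatExp hκ hα
  refine contDiff_prod fun q _ => ContDiff.mul (this.comp ?_) (this.comp ?_)
  · exact contDiff_const.add (coordCLM n p q).contDiff
  · exact contDiff_const.sub (coordCLM n p q).contDiff

theorem exists_boxKernel_gevreyBound (n p : ℕ) {κ α : ℝ} (hκ : 0 < κ) (hα : 0 < α) :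
    ∃ ρ : ℝ, 0 < ρ ∧ ∀ r x, GevreyBoundAt (1 + 1 / α) 1 ρ (boxKernel n p κ α r) x := by
  obtain ⟨ρ, hρ, h⟩ := exists_flatExp_gevreyBound hκ hα
  have hs : 0 ≤ 1 + 1 / α := by positivity
  have hc := contDiff_flatExp hκ hα
  refine ⟨(Fintype.card (Fin p × Fin n) : ℝ) * (ρ + ρ) + 1, by positivity, fun r x => ?_⟩
  have key : ∀ q : Fin p × Fin n, GevreyBoundAt (1 + 1 / α) 1 (ρ + ρ)
      (fun x : Fin p → Fin n → ℝ => flatExp κ α (r + x q.1 q.2) * flatExp κ α (r - x q.1 q.2))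
          x := by
    intro q
    have h1 : GevreyBoundAt (1 + 1 / α) 1 ρ
        (fun x : Fin p → Fin n → ℝ => flatExp κ α (r + x q.1 q.2)) x := by
      have h2 : ∀ y, GevreyBoundAt (1 + 1 / α) 1 ρ (fun t => flatExp κ α (t + r)) y :=
        fun y => (h _).comp_add
      have := (h2 (coordCLM n p q x)).comp_clm (coordCLM n p q)
        (hc.comp (contDiff_id.add contDiff_const))
      refine (this.mono zero_le_one (by positivity) le_rfl
        (mul_le_of_le_one_right hρ.le (norm_coordCLM_le n p q))).congr
        (Filter.Eventually.of_forall fun y => ?_)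
      simp only [coordCLM_apply, add_comm]
    have h3 : GevreyBoundAt (1 + 1 / α) 1 ρ
        (fun x : Fin p → Fin n → ℝ => flatExp κ α (r - x q.1 q.2)) x := by
      have h2 : ∀ y, GevreyBoundAt (1 + 1 / α) 1 ρ (fun t => flatExp κ α (t + r)) y :=
        fun y => (h _).comp_add
      have := (h2 ((-coordCLM n p q) x)).comp_clm (-coordCLM n p q)
        (hc.comp (contDiff_id.add contDiff_const))
      refine (this.mono zero_le_one (by positivity) le_rfl
        (mul_le_of_le_one_right hρ.le (by rw [norm_neg]; exact norm_coordCLM_le n p q))).congr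
        (Filter.Eventually.of_forall fun y => ?_)
      simp only [_root_.neg_apply, coordCLM_apply, neg_add_eq_sub]
    have := h1.mul hs h3 zero_le_one zero_le_one hρ.le hρ.le
      (hc.comp (contDiff_const.add (coordCLM n p q).contDiff))
      (hc.comp (contDiff_const.sub (coordCLM n p q).contDiff))
    rwa [one_mul] at this
  have := GevreyBoundAt.prod hs zero_le_one (by positivity : 0 ≤ ρ + ρ) Finset.univ
    (fun q _ => key q) (fun q _ => ContDiff.mul
      (hc.comp (contDiff_const.add (coordCLM n p q).contDiff))
      (hc.comp (contDiff_const.sub (coordCLM n p q).contDiff)))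
  rw [one_pow] at this
  exact this.mono zero_le_one (by positivity) le_rfl (by rw [Finset.card_univ]; linarith)

theorem norm_lt_of_boxKernel_ne_zero {n p : ℕ} {κ α r : ℝ} (hr : 0 < r)
    {x : Fin p → Fin n → ℝ} (h : boxKernel n p κ α r x ≠ 0) : ‖x‖ < r := by
  rw [boxKernel, Finset.prod_ne_zero_iff] at h
  rw [pi_norm_lt_iff hr]
  intro j
  rw [pi_norm_lt_iff hr]
  intro i
  have := h (j, i) (Finset.mem_univ _)
  rw [Real.norm_eq_abs, abs_lt]
  constructor
  · by_contra h'
    exact this (by rw [flatExp_of_nonpos κ α (by dsimp only; linarith), zero_mul])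
  · by_contra h'
    exact this (by rw [flatExp_of_nonpos κ α (x := r - _) (by dsimp only; linarith), mul_zero])

theorem boxKernel_nonneg (n p : ℕ) (κ α r : ℝ) (x : Fin p → Fin n → ℝ) :
    0 ≤ boxKernel n p κ α r x :=
  Finset.prod_nonneg fun _ _ => mul_nonneg (flatExp_nonneg _ _ _) (flatExp_nonneg _ _ _)

theorem le_boxKernel {n p : ℕ} {κ α r : ℝ} (hκ : 0 < κ) (hα : 0 < α) (hr : 0 < r)
    {x : Fin p → Fin n → ℝ} (hx : ‖x‖ ≤ r / 2) :
    Real.exp (-(2 * (p * n : ℕ) * κ * (r / 2) ^ (-α))) ≤ boxKernel n p κ α r x := by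
  have e : Real.exp (-(2 * (p * n : ℕ) * κ * (r / 2) ^ (-α))) = ∏ _q : Fin p × Fin n,
      (Real.exp (-κ * (r / 2) ^ (-α)) * Real.exp (-κ * (r / 2) ^ (-α))) := by
    rw [Finset.prod_const, ← Real.exp_add, ← Real.exp_nat_mul, Finset.card_univ, Fintype.card_prod,
      Fintype.card_fin, Fintype.card_fin]
    congr 1; push_cast; ring
  rw [e, boxKernel]
  refine Finset.prod_le_prod (fun _ _ => by positivity) fun q _ => ?_
  have hq : |x q.1 q.2| ≤ r / 2 :=
    ((norm_le_pi_norm (x q.1) q.2).trans (norm_le_pi_norm x q.1)).trans hx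
  rw [abs_le] at hq
  exact mul_le_mul (le_flatExp hκ hα (by positivity) (by linarith))
    (le_flatExp hκ hα (by positivity) (by linarith)) (by positivity) (flatExp_nonneg _ _ _)

theorem le_integral_boxKernel {n p : ℕ} {κ α r : ℝ} (hκ : 0 < κ) (hα : 0 < α) (hr : 0 < r) :
    Real.exp (-(2 * (p * n : ℕ) * κ * (r / 2) ^ (-α))) * ((r / 2) ^ (p * n) *
      (volume : Measure (Fin p → Fin n → ℝ)).real (Metric.ball 0 1)) ≤
      ∫ x, boxKernel n p κ α r x := by
  have hvol : (volume : Measure (Fin p → Fin n → ℝ)).real (Metric.closedBall 0 (r / 2)) =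
      (r / 2) ^ (p * n) * (volume : Measure (Fin p → Fin n → ℝ)).real (Metric.ball 0 1) := by
    rw [Measure.real, Measure.addHaar_closedBall _ _ (by positivity), ENNReal.toReal_mul,
      ENNReal.toReal_ofReal (by positivity), Measure.real]
    simp [Module.finrank_pi_fintype]
  have hcs : HasCompactSupport (boxKernel n p κ α r) :=
    HasCompactSupport.intro (isCompact_closedBall 0 r) fun y hy => by
      by_contra h
      exact hy (by rw [mem_closedBall_zero_iff]; exact (norm_lt_of_boxKernel_ne_zero hr h).le)
  have hker : Integrable (boxKernel n p κ α r) :=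
    (contDiff_boxKernel n p hκ hα r).continuous.integrable_of_hasCompactSupport hcs
  rw [← hvol]
  have h1 := setIntegral_ge_of_const_le_real (μ := (volume : Measure (Fin p → Fin n → ℝ)))
    (s := Metric.closedBall 0 (r / 2)) (f := boxKernel n p κ α r)
        Metric.isClosed_closedBall.measurableSet
    measure_closedBall_lt_top.ne
    (fun x hx => le_boxKernel hκ hα hr (mem_closedBall_zero_iff.1 hx)) hker.integrableOn
  exact h1.trans (setIntegral_le_integral hker
    (Filter.Eventually.of_forall fun x => boxKernel_nonneg _ _ _ _ _ _))

/-- Gevrey cutoff functions with sharp dependence on the width of the transition region. -/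
theorem exists_gevrey_cutoff (n p : ℕ) {α κ : ℝ} (hκ : 0 < κ) (hα : 0 < α) :
    ∃ C : ℝ, 0 < C ∧ ∃ ρ : ℝ, 0 < ρ ∧ ∀ r : ℝ, 0 < r → r ≤ 1 →
      ∀ A : Set (Fin p → Fin n → ℝ), ∃ χ : (Fin p → Fin n → ℝ) → ℝ,
        ContDiff ℝ (⊤ : ℕ∞) χ ∧ (∀ x ∈ A, χ x = 1) ∧
        (∀ x, (∀ a ∈ A, 2 * r ≤ dist x a) → χ x = 0) ∧
        ∀ x, GevreyBoundAt (1 + 1 / α) (C * Real.exp (κ * r ^ (-α))) ρ χ x := by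
  set d := p * n
  set κ' := κ / (4 * (d + 1) * 2 ^ α) with hκ'
  have hκ'0 : 0 < κ' := by positivity
  obtain ⟨ρ, hρ, hb⟩ := exists_boxKernel_gevreyBound n p hκ'0 hα
  set v := (volume : Measure (Fin p → Fin n → ℝ)).real (Metric.ball 0 1)
  set v' := (volume : Measure (Fin p → Fin n → ℝ)).real (Metric.closedBall 0 1)
  have hv : 0 < v := ENNReal.toReal_pos (Metric.measure_ball_pos _ _ one_pos).ne'
    measure_ball_lt_top.ne
  have hv' : 0 ≤ v' := measureReal_nonneg
  set m := ⌈(d : ℝ) / α⌉₊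
  set C₁ := (m ! : ℝ) * (κ / 2)⁻¹ ^ m
  have hC₁ : 0 < C₁ := by positivity
  refine ⟨2 ^ d * v⁻¹ * C₁ * v' + 1, by positivity, ρ, hρ, fun r hr hr1 A => ?_⟩
  have hI := le_integral_boxKernel (n := n) (p := p) hκ'0 hα hr
  have hlow : 0 < Real.exp (-(2 * (p * n : ℕ) * κ' * (r / 2) ^ (-α))) *
      ((r / 2) ^ (p * n) * v) := by
    positivity
  have hI0 := hlow.trans_le hI
  obtain ⟨χ, h1, h2, h3, h4⟩ := exists_cutoff_of_kernel volume hr1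
    (contDiff_boxKernel n p hκ'0 hα r) (fun x hx => norm_lt_of_boxKernel_ne_zero hr hx) hI0
    (hb r) A
  refine ⟨χ, h1, h2, h3, fun x => (h4 x).mono (by positivity) hρ.le ?_ le_rfl⟩
  set u := r ^ (-α) with hu
  have hu1 : 1 ≤ u := Real.one_le_rpow_of_pos_of_le_one_of_nonpos hr hr1 (by linarith)
  have hrd : (r ^ d)⁻¹ ≤ C₁ * Real.exp (κ / 2 * u) := by
    refine le_trans ?_ (pow_le_factorial_mul_exp (by positivity : 0 < κ / 2)
      (by linarith : 0 ≤ u) m)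
    calc (r ^ d)⁻¹ = u ^ ((d : ℝ) / α) := by
          rw [hu, ← Real.rpow_mul hr.le, ← Real.rpow_natCast, ← Real.rpow_neg hr.le]
          congr 1; field_simp
      _ ≤ u ^ (m : ℝ) := Real.rpow_le_rpow_of_exponent_le hu1 (Nat.le_ceil _)
      _ = u ^ m := Real.rpow_natCast _ _
  have hexp : 2 * (d : ℝ) * κ' * (r / 2) ^ (-α) ≤ κ / 2 * u := by
    rw [Real.div_rpow hr.le (by norm_num), ← hu, Real.rpow_neg (by norm_num : (0:ℝ) ≤ 2), hκ',
      div_inv_eq_mul]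
    have : 2 * (d : ℝ) * (κ / (4 * (d + 1) * 2 ^ α)) * (u * 2 ^ α) =
        (d / (d + 1)) * (κ / 2 * u) := by field_simp; ring
    rw [this]
    refine mul_le_of_le_one_left (by positivity) ?_
    rw [div_le_one (by positivity)]; linarith
  calc _ ≤ (Real.exp (-(2 * (d : ℕ) * κ' * (r / 2) ^ (-α))) * ((r / 2) ^ d * v))⁻¹ * (1 * v') := by
        gcongr
    _ = 2 ^ d * v⁻¹ * v' * ((r ^ d)⁻¹ * Real.exp (2 * (d : ℝ) * κ' * (r / 2) ^ (-α))) := by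
        rw [Real.exp_neg, mul_inv, inv_inv, mul_inv, div_pow, inv_div]; ring
    _ ≤ 2 ^ d * v⁻¹ * v' * ((C₁ * Real.exp (κ / 2 * u)) * Real.exp (κ / 2 * u)) := by
        gcongr
    _ = 2 ^ d * v⁻¹ * C₁ * v' * Real.exp (κ * u) := by
        rw [mul_assoc C₁, ← Real.exp_add]
        rw [show κ / 2 * u + κ / 2 * u = κ * u by ring]; ring
    _ ≤ _ := by gcongr; linarith

end Cutoff

section Cauchy

variable {E : Type} [NormedAddCommGroup E] [NormedSpace ℂ E]

theorem norm_fderiv_le_of_norm_le_closedBall {F : Type} [NormedAddCommGroup F] [NormedSpace ℂ F]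
    {T : E → F} (hT : Differentiable ℂ T) {a : E} {M s : ℝ} (hs : 0 < s)
    (hM : ∀ z ∈ Metric.closedBall a s, ‖T z‖ ≤ M) : ‖fderiv ℂ T a‖ ≤ 2 * M / s := by
  refine Complex.norm_fderiv_le_div_of_mapsTo_ball hT.differentiableOn (fun z hz => ?_) hs
  rw [mem_closedBall_iff_norm]
  refine (norm_sub_le _ _).trans ?_
  linarith [hM z (Metric.ball_subset_closedBall hz), hM a (Metric.mem_closedBall_self hs.le)]

theorem norm_iteratedFDeriv_le_of_norm_le_closedBall {F : Type} [NormedAddCommGroup F]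
    [NormedSpace ℂ F] {T : E → F} (hT : ContDiff ℂ (⊤ : ℕ∞) T) (k : ℕ) {a : E} {M s : ℝ}
    (hs : 0 < s) (hM : ∀ z ∈ Metric.closedBall a (k * s), ‖T z‖ ≤ M) :
    ‖iteratedFDeriv ℂ k T a‖ ≤ M * (2 / s) ^ k := by
  induction k generalizing F M with
  | zero =>
    rw [norm_iteratedFDeriv_zero, pow_zero, mul_one]
    exact hM a (by simp)
  | succ k ih =>
    rw [← norm_iteratedFDeriv_fderiv]
    have := ih (M := 2 * M / s) (hT.fderiv_right (m := (⊤ : ℕ∞)) (by exact_mod_cast le_top))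
      (fun z hz => norm_fderiv_le_of_norm_le_closedBall (hT.differentiable (by simp)) hs
        fun w hw => hM w ?_)
    · refine this.trans (le_of_eq ?_)
      rw [pow_succ]; ring
    · rw [Metric.mem_closedBall] at hz hw ⊢
      push_cast
      linarith [dist_triangle w z a]

/-- Normal convergence on bounded sets. -/
def LocallySummable {F : Type} [NormedAddCommGroup F] (f : ℕ → E → F) : Prop :=
  ∀ R : ℝ, ∃ u : ℕ → ℝ, Summable u ∧ ∀ m z, ‖z‖ ≤ R → ‖f m z‖ ≤ u m

theorem LocallySummable.fderiv {F : Type} [NormedAddCommGroup F] [NormedSpace ℂ F]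
    {f : ℕ → E → F} (H : LocallySummable f) (hf : ∀ m, Differentiable ℂ (f m)) :
    LocallySummable fun m => fderiv ℂ (f m) := fun R => by
  obtain ⟨u, hu, h⟩ := H (R + 1)
  refine ⟨fun m => 2 * u m / 1, (hu.mul_left 2).div_const 1, fun m z hz => ?_⟩
  refine norm_fderiv_le_of_norm_le_closedBall (hf m) one_pos fun w hw => h m w ?_
  rw [mem_closedBall_iff_norm] at hw
  linarith [norm_le_norm_add_norm_sub' w z]

theorem LocallySummable.hasFDerivAt_tsum {F : Type} [NormedAddCommGroup F] [NormedSpace ℂ F]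
    [CompleteSpace F] {f : ℕ → E → F} (H : LocallySummable f) (hf : ∀ m, Differentiable ℂ (f m))
    (z : E) : HasFDerivAt (fun z => ∑' m, f m z) (∑' m, _root_.fderiv ℂ (f m) z) z := by
  obtain ⟨u, hu, h⟩ := H.fderiv hf (‖z‖ + 1)
  obtain ⟨v, hv, h'⟩ := H ‖z‖
  have hz : z ∈ Metric.ball (0 : E) (‖z‖ + 1) := by simp
  exact hasFDerivAt_tsum_of_isPreconnected hu Metric.isOpen_ball
    (convex_ball (0 : E) (‖z‖ + 1)).isPreconnected
    (fun m w _ => (hf m w).hasFDerivAt)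
    (fun m w hw => h m w (mem_ball_zero_iff.1 hw).le) hz
    (hv.of_norm_bounded fun m => h' m z le_rfl) hz

theorem LocallySummable.contDiff_tsum {F : Type} [NormedAddCommGroup F] [NormedSpace ℂ F]
    [CompleteSpace F] {f : ℕ → E → F} (H : LocallySummable f)
    (hf : ∀ m, ContDiff ℂ (⊤ : ℕ∞) (f m)) :
    ContDiff ℂ (⊤ : ℕ∞) (fun z => ∑' m, f m z) := by
  rw [contDiff_infty]
  intro k
  have hf1 : ∀ m, Differentiable ℂ (f m) := fun m => (hf m).differentiable (by simp)
  induction k generalizing F with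
  | zero =>
    exact contDiff_zero.2 (continuous_iff_continuousAt.2 fun z =>
      (H.hasFDerivAt_tsum hf1 z).continuousAt)
  | succ k ih =>
    push_cast
    rw [contDiff_succ_iff_fderiv]
    refine ⟨fun z => (H.hasFDerivAt_tsum hf1 z).differentiableAt, by simp, ?_⟩
    rw [show _root_.fderiv ℂ (fun z => ∑' m, f m z) = fun z => ∑' m, _root_.fderiv ℂ (f m) z from
      funext fun z => (H.hasFDerivAt_tsum hf1 z).fderiv]
    have hf' : ∀ m, ContDiff ℂ (⊤ : ℕ∞) (_root_.fderiv ℂ (f m)) := fun m =>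
      (hf m).fderiv_right (m := (⊤ : ℕ∞)) (by exact_mod_cast le_top)
    exact ih (H.fderiv hf1) hf' fun m => (hf' m).differentiable (by simp)

end Cauchy

/-- Coordinatewise inclusion of real points into complex points. -/
noncomputable def ofRealPi (n p : ℕ) : (Fin p → Fin n → ℝ) →L[ℝ] (Fin p → Fin n → ℂ) :=
  ContinuousLinearMap.pi fun j => ContinuousLinearMap.pi fun i =>
    Complex.ofRealCLM.comp (coordCLM n p (j, i))

theorem ofRealPi_apply (n p : ℕ) (x : Fin p → Fin n → ℝ) (j : Fin p) (i : Fin n) :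
    ofRealPi n p x j i = (x j i : ℂ) := rfl

theorem norm_ofRealPi_apply (n p : ℕ) (x : Fin p → Fin n → ℝ) : ‖ofRealPi n p x‖ = ‖x‖ := by
  simp only [Pi.norm_def, Pi.nnnorm_def, ofRealPi_apply]
  simp

theorem norm_ofRealPi_le (n p : ℕ) : ‖ofRealPi n p‖ ≤ 1 :=
  ContinuousLinearMap.opNorm_le_bound _ zero_le_one fun x => by rw [norm_ofRealPi_apply, one_mul]

theorem contDiff_comp_ofRealPi {n p : ℕ} {T : (Fin p → Fin n → ℂ) → ℂ}
    (hT : ContDiff ℂ (⊤ : ℕ∞) T) : ContDiff ℝ (⊤ : ℕ∞) fun x => T (ofRealPi n p x) :=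
  (hT.restrict_scalars ℝ).comp (ofRealPi n p).contDiff

theorem norm_iteratedFDeriv_comp_ofRealPi_le {n p : ℕ} {T : (Fin p → Fin n → ℂ) → ℂ}
    (hT : ContDiff ℂ (⊤ : ℕ∞) T) (k : ℕ) (x : Fin p → Fin n → ℝ) :
    ‖iteratedFDeriv ℝ k (fun x => T (ofRealPi n p x)) x‖ ≤
      ‖iteratedFDeriv ℂ k T (ofRealPi n p x)‖ := by
  have h := (ofRealPi n p).iteratedFDeriv_comp_right (hT.restrict_scalars ℝ) x (i := k)
    (by exact_mod_cast le_top)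
  rw [show (fun x => T (ofRealPi n p x)) = T ∘ ofRealPi n p from rfl, h,
    ← ContDiffAt.restrictScalars_iteratedFDeriv (𝕜' := ℂ) (n := k)
      (hT.of_le (by exact_mod_cast le_top)).contDiffAt]
  refine (ContinuousMultilinearMap.norm_compContinuousLinearMap_le _ _).trans ?_
  rw [Finset.prod_const, Finset.card_univ, Fintype.card_fin]
  refine (mul_le_of_le_one_right (norm_nonneg _)
    (pow_le_one₀ (norm_nonneg _) (norm_ofRealPi_le n p))).trans ?_
  simp

section Roots

/-- The vector of elementary symmetric polynomials evaluated at `z`. -/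
def esymmVec {R : Type} [CommSemiring R] {n : ℕ} (z : Fin n → R) (i : Fin n) : R :=
  ∑ t ∈ Finset.univ.powersetCard (i.1 + 1), ∏ r ∈ t, z r

/-- The monic polynomial with signed coefficient vector `a`. -/
noncomputable def vietaPoly {n : ℕ} (a : Fin n → ℂ) : Polynomial ℂ :=
  Polynomial.X ^ n +
    ∑ i : Fin n, Polynomial.C ((-1) ^ (i.1 + 1) * a i) * Polynomial.X ^ (n - (i.1 + 1))

theorem eval_vietaPoly {n : ℕ} (a : Fin n → ℂ) (ζ : ℂ) :
    (vietaPoly a).eval ζ = ζ ^ n + ∑ i : Fin n, (-1) ^ (i.1 + 1) * a i * ζ ^ (n - (i.1 + 1)) := by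
  simp [vietaPoly, Polynomial.eval_finsetSum]

theorem degree_vietaPoly_sub_lt {n : ℕ} (a : Fin n → ℂ) :
    (∑ i : Fin n, Polynomial.C ((-1) ^ (i.1 + 1) * a i) *
      (Polynomial.X : Polynomial ℂ) ^ (n - (i.1 + 1))).degree < n := by
  refine (Polynomial.degree_sum_le _ _).trans_lt ?_
  refine (Finset.sup_lt_iff (WithBot.bot_lt_coe n)).2 fun i _ => ?_
  refine (Polynomial.degree_C_mul_X_pow_le _ _).trans_lt ?_
  have := i.2
  exact WithBot.coe_lt_coe.2 (by omega : n - (i.1 + 1) < n)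

theorem vietaPoly_monic {n : ℕ} (a : Fin n → ℂ) : (vietaPoly a).Monic :=
  Polynomial.monic_X_pow_add (degree_vietaPoly_sub_lt a)

theorem natDegree_vietaPoly {n : ℕ} (a : Fin n → ℂ) : (vietaPoly a).natDegree = n := by
  apply Polynomial.natDegree_eq_of_degree_eq_some
  rw [vietaPoly, Polynomial.degree_add_eq_left_of_degree_lt, Polynomial.degree_X_pow]
  rw [Polynomial.degree_X_pow]; exact degree_vietaPoly_sub_lt a

theorem coeff_vietaPoly {n : ℕ} (a : Fin n → ℂ) (i : Fin n) :
    (vietaPoly a).coeff (n - (i.1 + 1)) = (-1) ^ (i.1 + 1) * a i := by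
  have hi := i.2
  simp only [vietaPoly, Polynomial.coeff_add, Polynomial.coeff_X_pow, Polynomial.finsetSum_coeff,
    Polynomial.coeff_C_mul, Polynomial.coeff_X_pow]
  rw [if_neg (by omega), zero_add, Finset.sum_eq_single i]
  · simp
  · intro b _ hb
    have := b.2
    rw [if_neg, mul_zero]
    intro h
    exact hb (Fin.ext (by omega))
  · simp

theorem prod_X_sub_C_eq_vietaPoly {n : ℕ} (z : Fin n → ℂ) :
    ∏ i, (Polynomial.X - Polynomial.C (z i)) = vietaPoly (esymmVec z) := by
  have h := Multiset.prod_X_sub_X_eq_sum_esymm ((Finset.univ : Finset (Fin n)).val.map z)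
  rw [Multiset.map_map] at h
  simp only [Multiset.card_map, Finset.card_val, Finset.card_univ, Fintype.card_fin,
    Finset.esymm_map_val] at h
  rw [Finset.sum_range_succ'] at h
  rw [Finset.prod_eq_multiset_prod]
  refine h.trans ?_
  rw [vietaPoly, add_comm]
  congr 1
  · simp
  · rw [← Fin.sum_univ_eq_sum_range (fun j => (-1 : Polynomial ℂ) ^ (j + 1) *
      (Polynomial.C (∑ t ∈ Finset.powersetCard (j + 1) Finset.univ, t.prod z) *
        Polynomial.X ^ (n - (j + 1))))]
    refine Finset.sum_congr rfl fun i _ => ?_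
    rw [esymmVec, Polynomial.C_mul, Polynomial.C_pow, Polynomial.C_neg, Polynomial.C_1, mul_assoc]

theorem prod_sub_eq {n : ℕ} (z : Fin n → ℂ) (ζ : ℂ) :
    ∏ i, (ζ - z i) = ζ ^ n + ∑ i : Fin n, (-1) ^ (i.1 + 1) * esymmVec z i *
        ζ ^ (n - (i.1 + 1)) := by
  rw [← eval_vietaPoly, ← prod_X_sub_C_eq_vietaPoly, Polynomial.eval_prod]
  simp

theorem esymmVec_surjective {n : ℕ} (a : Fin n → ℂ) : ∃ z : Fin n → ℂ, esymmVec z = a := by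
  have hs := IsAlgClosed.splits (vietaPoly a)
  have hcard : (vietaPoly a).roots.toList.length = n := by
    rw [Multiset.length_toList, ← hs.natDegree_eq_card_roots, natDegree_vietaPoly]
  obtain ⟨z, hz⟩ : ∃ z : Fin n → ℂ, List.ofFn z = (vietaPoly a).roots.toList :=
    ⟨fun i => (vietaPoly a).roots.toList.get (i.cast hcard.symm), by
      apply List.ext_get (by simp [hcard]); intro k h1 h2; simp⟩
  have h := hs.eq_prod_roots_of_monic (vietaPoly_monic a)
  rw [← Multiset.coe_toList (vietaPoly a).roots, ← hz, ← Fin.univ_val_map, Multiset.map_map] at h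
  have h2 : vietaPoly a = vietaPoly (esymmVec z) := by
    rw [← prod_X_sub_C_eq_vietaPoly, Finset.prod_eq_multiset_prod]; exact h
  refine ⟨z, funext fun i => ?_⟩
  have h3 := coeff_vietaPoly (esymmVec z) i
  rw [← h2, coeff_vietaPoly] at h3
  exact (mul_left_cancel₀ (pow_ne_zero _ (by norm_num)) h3).symm

theorem norm_le_of_esymmVec {n : ℕ} (z : Fin n → ℂ) : ‖z‖ ≤ 1 + n * ‖esymmVec z‖ := by
  refine (pi_norm_le_iff_of_nonneg (by positivity)).2 fun j => ?_
  by_contra! hj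
  have h1 : 1 < ‖z j‖ := by
    have : 0 ≤ n * ‖esymmVec z‖ := by positivity
    linarith
  have h := prod_sub_eq z (z j)
  rw [Finset.prod_eq_zero (Finset.mem_univ j) (sub_self _)] at h
  have h2 : ‖z j‖ ^ n ≤ ∑ _i : Fin n, ‖esymmVec z‖ * ‖z j‖ ^ (n - 1) := by
    rw [← norm_pow, eq_neg_of_add_eq_zero_left h.symm, norm_neg]
    refine norm_sum_le_of_le _ fun i _ => ?_
    rw [norm_mul, norm_mul, norm_pow, norm_neg, norm_one, one_pow, one_mul, norm_pow]
    gcongr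
    · exact norm_le_pi_norm _ i
    · exact h1.le
    · omega
  have hn : n = (n - 1) + 1 := by have := j.2; omega
  rw [Finset.sum_const, Finset.card_univ, Fintype.card_fin, nsmul_eq_mul] at h2
  have h3 : ‖z j‖ ^ n = ‖z j‖ * ‖z j‖ ^ (n - 1) := by rw [← pow_succ', ← hn]
  rw [h3, ← mul_assoc] at h2
  have := le_of_mul_le_mul_right h2 (by positivity)
  linarith

theorem abs_im_pow_le {n : ℕ} (z : Fin n → ℂ) (x : Fin n → ℝ) (j : Fin n) {r B : ℝ}
    (hB : 1 ≤ B) (hzB : ‖z‖ ≤ B)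
    (hr : ‖esymmVec z - esymmVec (fun i => (x i : ℂ))‖ ≤ r) : |(z j).im| ^ n ≤ n * r * B ^ n := by
  have h1 := prod_sub_eq z (z j)
  rw [Finset.prod_eq_zero (Finset.mem_univ j) (sub_self _)] at h1
  have h2 := prod_sub_eq (fun i => (x i : ℂ)) (z j)
  have h3 : |(z j).im| ^ n ≤ ‖∏ i, (z j - (x i : ℂ))‖ := by
    rw [norm_prod]
    calc |(z j).im| ^ n = ∏ _i : Fin n, |(z j).im| := by simp
      _ ≤ _ := Finset.prod_le_prod (fun _ _ => abs_nonneg _) fun i _ => by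
        have := Complex.abs_im_le_norm (z j - (x i : ℂ))
        simpa using this
  refine h3.trans ?_
  have hzj : ‖z j‖ ≤ B := (norm_le_pi_norm z j).trans hzB
  have h4 : ∏ i, (z j - (x i : ℂ)) = ∑ i : Fin n, (-1) ^ (i.1 + 1) *
      (-(esymmVec z - esymmVec (fun i => (x i : ℂ))) i) * (z j) ^ (n - (i.1 + 1)) := by
    rw [h2, eq_neg_of_add_eq_zero_left h1.symm, neg_add_eq_sub, ← Finset.sum_sub_distrib]
    refine Finset.sum_congr rfl fun i _ => ?_
    simp only [Pi.sub_apply]; ring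
  rw [h4]
  have h5 : ∀ i ∈ (Finset.univ : Finset (Fin n)), ‖(-1) ^ (i.1 + 1) *
      (-(esymmVec z - esymmVec (fun i => (x i : ℂ))) i) * (z j) ^ (n - (i.1 + 1))‖ ≤ r * B ^ n := by
    intro i _
    rw [norm_mul, norm_mul, norm_pow, norm_neg, norm_one, one_pow, one_mul, norm_pow, norm_neg]
    have := (norm_nonneg _).trans hr
    gcongr
    · exact (norm_le_pi_norm _ i).trans hr
    · calc ‖z j‖ ^ (n - (i.1 + 1)) ≤ B ^ (n - (i.1 + 1)) := by gcongr
        _ ≤ B ^ n := pow_le_pow_right₀ hB (by omega)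
  refine (norm_sum_le_of_le _ h5).trans (le_of_eq ?_)
  rw [Finset.sum_const, Finset.card_univ, Fintype.card_fin, nsmul_eq_mul, mul_assoc]

end Roots

section SymmExp

theorem exists_polynomial_esymmVec {n : ℕ} (P : MvPolynomial (Fin n) ℂ) (hP : P.IsSymmetric) :
    ∃ Q : MvPolynomial (Fin n) ℂ, ∀ z, MvPolynomial.eval (esymmVec z) Q =
        MvPolynomial.eval z P := by
  obtain ⟨Q, hQ⟩ := MvPolynomial.esymmAlgHom_surjective (σ := Fin n) (n := n) ℂ (by simp)
    ⟨P, (MvPolynomial.mem_symmetricSubalgebra P).2 hP⟩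
  refine ⟨Q, fun z => ?_⟩
  have h : MvPolynomial.aeval _ Q = P :=
    (MvPolynomial.esymmAlgHom_apply Q).symm.trans (congrArg Subtype.val hQ)
  rw [← h]
  change _ = MvPolynomial.aeval z _
  rw [MvPolynomial.comp_aeval_apply, ← MvPolynomial.coe_aeval_eq_eval]
  simp only [MvPolynomial.esymm, map_sum, map_prod, MvPolynomial.aeval_X]
  rfl

/-- The average over the symmetric group of the exponential with frequency `η`. -/
noncomputable def symmExp {n : ℕ} (η : Fin n → ℝ) (z : Fin n → ℂ) : ℂ :=
  (n ! : ℂ)⁻¹ * ∑ w : Equiv.Perm (Fin n), Complex.exp (Complex.I * ∑ k, (η k : ℂ) * z (w k))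

theorem norm_sum_mul_le {n : ℕ} (η : Fin n → ℝ) (z : Fin n → ℂ) (w : Equiv.Perm (Fin n)) :
    ‖Complex.I * ∑ k, (η k : ℂ) * z (w k)‖ ≤ n * ‖η‖ * ‖z‖ := by
  rw [norm_mul, Complex.norm_I, one_mul]
  refine (norm_sum_le_of_le _ (fun k _ => ?_) : _ ≤ ∑ _k : Fin n, ‖η‖ * ‖z‖).trans (le_of_eq ?_)
  · rw [norm_mul, Complex.norm_real]
    gcongr
    · exact norm_le_pi_norm η k
    · exact norm_le_pi_norm z _
  · simp [mul_assoc]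

theorem norm_symmExp_le {n : ℕ} (η : Fin n → ℝ) (z : Fin n → ℂ) {b : ℝ} (hb : ∀ k, |(z k).im| ≤ b) :
    ‖symmExp η z‖ ≤ Real.exp (n * ‖η‖ * b) := by
  rw [symmExp, norm_mul, norm_inv, Complex.norm_natCast]
  have h1 : ∀ w ∈ (Finset.univ : Finset (Equiv.Perm (Fin n))),
      ‖Complex.exp (Complex.I * ∑ k, (η k : ℂ) * z (w k))‖ ≤ Real.exp (n * ‖η‖ * b) := by
    intro w _
    rw [Complex.norm_exp]
    apply Real.exp_le_exp.2
    have : (Complex.I * ∑ k, (η k : ℂ) * z (w k)).re = ∑ k, -(η k * (z (w k)).im) := by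
      rw [Complex.I_mul_re, Complex.im_sum, ← Finset.sum_neg_distrib]
      simp
    rw [this]
    calc ∑ k, -(η k * (z (w k)).im) ≤ ∑ _k : Fin n, ‖η‖ * b := Finset.sum_le_sum fun k _ => by
          refine (neg_le_abs _).trans ?_
          rw [abs_mul]
          exact mul_le_mul (norm_le_pi_norm η k) (hb _) (abs_nonneg _) (norm_nonneg _)
      _ = _ := by simp [mul_assoc]
  refine (mul_le_mul_of_nonneg_left (norm_sum_le_of_le _ h1) (by positivity)).trans (le_of_eq ?_)
  rw [Finset.sum_const, Finset.card_univ, Fintype.card_perm, Fintype.card_fin, nsmul_eq_mul]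
  have : (n ! : ℝ) ≠ 0 := by positivity
  field_simp

theorem exists_entire_symmExp {n : ℕ} (η : Fin n → ℝ) :
    ∃ T : (Fin n → ℂ) → ℂ, ContDiff ℂ (⊤ : ℕ∞) T ∧ ∀ z, T (esymmVec z) = symmExp η z := by
  set P : ℕ → MvPolynomial (Fin n) ℂ := fun m => MvPolynomial.C ((n ! : ℂ)⁻¹ * (m ! : ℂ)⁻¹) *
    ∑ w : Equiv.Perm (Fin n), (∑ k, MvPolynomial.C (Complex.I * η k) * MvPolynomial.X (w k)) ^ m
    with hPdef
  have hP : ∀ m, (P m).IsSymmetric := by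
    intro m e
    simp only [hPdef, map_mul, MvPolynomial.rename_C, map_sum, map_pow, MvPolynomial.rename_X]
    congr 1
    exact Fintype.sum_equiv (Equiv.mulLeft e) _ _ fun w => by simp
  choose Q hQ using fun m => exists_polynomial_esymmVec (P m) (hP m)
  have hval : ∀ m z, MvPolynomial.eval (esymmVec z) (Q m) = (n ! : ℂ)⁻¹ *
      ∑ w : Equiv.Perm (Fin n), (Complex.I * ∑ k, (η k : ℂ) * z (w k)) ^ m / (m ! : ℂ) := by
    intro m z
    rw [hQ, hPdef]
    simp only [map_mul, MvPolynomial.eval_C, map_sum, map_pow, MvPolynomial.eval_X]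
    rw [mul_assoc, Finset.mul_sum]
    congr 1
    refine Finset.sum_congr rfl fun w _ => ?_
    rw [Finset.mul_sum, div_eq_mul_inv, mul_comm]
    simp only [mul_assoc]
  have hloc : LocallySummable fun m (a : Fin n → ℂ) => MvPolynomial.eval a (Q m) := by
    intro R
    refine ⟨fun m => (n * ‖η‖ * (1 + n * |R|)) ^ m / m !, Real.summable_pow_div_factorial _,
      fun m a ha => ?_⟩
    obtain ⟨z, rfl⟩ := esymmVec_surjective a
    have hz : ‖z‖ ≤ 1 + n * |R| := (norm_le_of_esymmVec z).trans (by
      have := ha.trans (le_abs_self R); gcongr)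
    beta_reduce
    rw [hval, norm_mul, norm_inv, Complex.norm_natCast]
    have h1 : ∀ w ∈ (Finset.univ : Finset (Equiv.Perm (Fin n))),
        ‖(Complex.I * ∑ k, (η k : ℂ) * z (w k)) ^ m / (m ! : ℂ)‖ ≤
          (n * ‖η‖ * (1 + n * |R|)) ^ m / m ! := by
      intro w _
      rw [norm_div, norm_pow, Complex.norm_natCast]
      have := (norm_sum_mul_le η z w).trans (mul_le_mul_of_nonneg_left hz (by positivity))
      gcongr
    refine (mul_le_mul_of_nonneg_left (norm_sum_le_of_le _ h1) (by positivity)).trans (le_of_eq ?_)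
    rw [Finset.sum_const, Finset.card_univ, Fintype.card_perm, Fintype.card_fin, nsmul_eq_mul]
    have : (n ! : ℝ) ≠ 0 := by positivity
    field_simp
  refine ⟨_, hloc.contDiff_tsum fun m => (AnalyticOnNhd.eval_mvPolynomial (Q m)).contDiff,
    fun z => ?_⟩
  simp_rw [hval]
  refine HasSum.tsum_eq (HasSum.mul_left _ (hasSum_sum fun w _ => ?_))
  rw [Complex.exp_eq_exp_ℂ]
  exact NormedSpace.expSeries_div_hasSum_exp _

/-- The complexification of `theta`. -/
def thetaC {n p : ℕ} (z : Fin p → Fin n → ℂ) (j : Fin p) : Fin n → ℂ := esymmVec (z j)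

theorem exists_entire_prod_symmExp {n p : ℕ} (η : Fin p → Fin n → ℝ) :
    ∃ T : (Fin p → Fin n → ℂ) → ℂ, ContDiff ℂ (⊤ : ℕ∞) T ∧
      ∀ z, T (thetaC z) = ∏ j, symmExp (η j) (z j) := by
  choose T hT hT' using fun j => exists_entire_symmExp (η j)
  refine ⟨fun a => ∏ j, T j (a j), contDiff_prod fun j _ => (hT j).comp (contDiff_apply ℂ _ j),
    fun z => Finset.prod_congr rfl fun j _ => hT' j (z j)⟩

theorem ofRealPi_theta (n p : ℕ) (x : Fin p → Fin n → ℝ) :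
    ofRealPi n p (theta n p x) = thetaC (ofRealPi n p x) := by
  ext j i
  simp [ofRealPi_apply, theta, thetaC, esymmVec]

end SymmExp

section Extension

theorem continuous_theta (n p : ℕ) : Continuous (theta n p) := by
  refine continuous_pi fun j => continuous_pi fun i => ?_
  simp only [theta]
  fun_prop

theorem norm_prod_symmExp_le {n p : ℕ} (η : Fin p → Fin n → ℝ) (z : Fin p → Fin n → ℂ) {b : ℝ}
    (hb0 : 0 ≤ b) (hb : ∀ j k, |(z j k).im| ≤ b) :
    ‖∏ j, symmExp (η j) (z j)‖ ≤ Real.exp (p * (n * ‖η‖ * b)) := by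
  rw [norm_prod, Real.exp_nat_mul]
  calc _ ≤ ∏ _j : Fin p, Real.exp (n * ‖η‖ * b) :=
        Finset.prod_le_prod (fun _ _ => norm_nonneg _) fun j _ => by
          refine (norm_symmExp_le (η j) (z j) (hb j)).trans (Real.exp_le_exp.2 ?_)
          have := norm_le_pi_norm η j
          gcongr
    _ = _ := by simp

/-- A symmetrized exponential is bounded near real values of `theta` by the imaginary parts of
the roots. -/
theorem norm_le_of_near_theta {n p : ℕ} {T : (Fin p → Fin n → ℂ) → ℂ} {η : Fin p → Fin n → ℝ}
    (hT : ∀ z, T (thetaC z) = ∏ j, symmExp (η j) (z j)) {B b r : ℝ} (hn : n ≠ 0)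
    (hb0 : 0 ≤ b) {x : Fin p → Fin n → ℝ}
    (hB : 1 + n * (‖theta n p x‖ + r) ≤ B) (hr : n * r * B ^ n ≤ b ^ n)
    {a : Fin p → Fin n → ℂ} (ha : ‖a - ofRealPi n p (theta n p x)‖ ≤ r) :
    ‖T a‖ ≤ Real.exp (p * (n * ‖η‖ * b)) := by
  choose z hz using fun j => esymmVec_surjective (a j)
  have hza : thetaC z = a := funext hz
  have hr0 : 0 ≤ r := (norm_nonneg _).trans ha
  rw [← hza, hT]
  refine norm_prod_symmExp_le η z hb0 fun j k => ?_
  have haj : ‖a‖ ≤ ‖theta n p x‖ + r := by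
    rw [← norm_ofRealPi_apply n p (theta n p x)]
    linarith [norm_le_norm_add_norm_sub' a (ofRealPi n p (theta n p x))]
  have h0 : 0 ≤ (n : ℝ) * (‖theta n p x‖ + r) := by positivity
  refine le_of_pow_le_pow_left₀ hn hb0 (le_trans ?_ hr)
  refine abs_im_pow_le (z j) (x j) k (by linarith) ?_ ?_
  · refine (norm_le_of_esymmVec (z j)).trans (le_trans ?_ hB)
    rw [hz]
    have := (norm_le_pi_norm a j).trans haj
    gcongr
  · rw [hz]
    refine le_trans ?_ ha
    rw [ofRealPi_theta]
    exact norm_le_pi_norm (a - thetaC (ofRealPi n p x)) j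

theorem gevreyBoundAt_comp_ofRealPi {n p : ℕ} {T : (Fin p → Fin n → ℂ) → ℂ}
    (hT : ContDiff ℂ (⊤ : ℕ∞) T) {β μ ε N M r : ℝ} (hβ : 0 < β) (hμ : 0 < μ) (hε : 0 < ε)
    (hN : 0 < N) (hr : r⁻¹ = ε⁻¹ * N ^ β) {a : Fin p → Fin n → ℝ}
    (hM : ∀ z ∈ Metric.closedBall (ofRealPi n p a) r, ‖T z‖ ≤ M) :
    GevreyBoundAt (1 + β) (Real.exp 1 * M * Real.exp (μ * β * N))
      (2 * Real.exp 1 * ε⁻¹ * μ⁻¹ ^ β) (fun x => T (ofRealPi n p x)) a := by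
  intro k
  have hr0 : 0 < r := inv_pos.1 (by rw [hr]; positivity)
  have hM0 : 0 ≤ M := (norm_nonneg _).trans (hM _ (Metric.mem_closedBall_self hr0.le))
  refine (norm_iteratedFDeriv_comp_ofRealPi_le hT k a).trans ?_
  refine (norm_iteratedFDeriv_le_of_norm_le_closedBall hT k (s := r / (k + 1)) (M := M)
    (by positivity) fun z hz => hM z (Metric.closedBall_subset_closedBall ?_ hz)).trans ?_
  · rw [mul_div_assoc', div_le_iff₀ (by positivity)]
    nlinarith
  have h1 : ((k : ℝ) + 1) ^ k ≤ k ! * (Real.exp 1 * Real.exp 1 ^ k) := by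
    have := pow_le_factorial_mul_exp one_pos (by positivity : (0 : ℝ) ≤ k + 1) k
    rw [inv_one, one_pow, mul_one, one_mul, Real.exp_add] at this
    rw [← Real.exp_nat_mul, mul_one]
    linarith
  have h2 : (N ^ β) ^ k ≤ (k ! : ℝ) ^ β * (μ⁻¹ ^ β) ^ k * Real.exp (μ * β * N) := by
    have h := Real.rpow_le_rpow (by positivity) (pow_le_factorial_mul_exp hμ hN.le k) hβ.le
    rw [Real.mul_rpow (by positivity) (by positivity), Real.mul_rpow (by positivity)
        (by positivity),
      ← Real.exp_mul] at h
    have e : ∀ y : ℝ, 0 ≤ y → (y ^ k) ^ β = (y ^ β) ^ k := fun y hy => by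
      rw [← Real.rpow_natCast, ← Real.rpow_natCast, ← Real.rpow_mul hy, ← Real.rpow_mul hy,
        mul_comm (k : ℝ)]
    rw [e N hN.le, e μ⁻¹ (by positivity)] at h
    rwa [mul_right_comm μ] at h
  calc M * (2 / (r / (k + 1))) ^ k = M * 2 ^ k * ε⁻¹ ^ k * (((k : ℝ) + 1) ^ k * (N ^ β) ^ k) := by
        rw [show 2 / (r / ((k : ℝ) + 1)) = 2 * (k + 1) * r⁻¹ by field_simp, hr]
        simp only [mul_pow]; ring
    _ ≤ M * 2 ^ k * ε⁻¹ ^ k * ((k ! * (Real.exp 1 * Real.exp 1 ^ k)) *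
          ((k ! : ℝ) ^ β * (μ⁻¹ ^ β) ^ k * Real.exp (μ * β * N))) := by gcongr
    _ = _ := by
        rw [Real.rpow_add (by positivity), Real.rpow_one]
        simp only [mul_pow]; ring

theorem exists_gevrey_symmExp_extension {n : ℕ} (p : ℕ) (hn : 1 ≤ n) {δ Λ c : ℝ} (hδ : 0 < δ)
    (hΛ : 0 < Λ) (hc : 0 < c) (R : ℝ) :
    ∃ C : ℝ, 0 < C ∧ ∃ ρ : ℝ, 0 < ρ ∧ ∀ L : ℝ, 1 ≤ L → ∀ η : Fin p → Fin n → ℝ, ‖η‖ ≤ Λ * L →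
      ∃ ψ : (Fin p → Fin n → ℝ) → ℂ, ContDiff ℝ (⊤ : ℕ∞) ψ ∧
        (∀ x, ‖x‖ ≤ R → ψ (theta n p x) = ∏ j, symmExp (η j) (fun i => (x j i : ℂ))) ∧
        ∀ a, GevreyBoundAt (1 + n * δ) (C * Real.exp (c * L ^ (1 / (1 + δ)))) ρ ψ a := by
  have hn0 : (0 : ℝ) < n := by exact_mod_cast hn
  obtain ⟨S, hS⟩ := ((isCompact_closedBall (0 : Fin p → Fin n → ℝ) R).image
    (continuous_theta n p)).isBounded.exists_norm_le
  have hS' : ∀ x : Fin p → Fin n → ℝ, ‖x‖ ≤ R → ‖theta n p x‖ ≤ |S| := fun x hx =>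
    (hS _ ⟨x, mem_closedBall_zero_iff.2 hx, rfl⟩).trans (le_abs_self S)
  set B : ℝ := 1 + n * (|S| + 1) with hB
  have hB1 : 1 ≤ B := by rw [hB]; have : 0 ≤ (n : ℝ) * (|S| + 1) := by positivity
                         linarith
  set ε₁ : ℝ := min 1 (c / 3 / ((p + 1) * n * Λ * B)) with hε₁
  have hε₁0 : 0 < ε₁ := by positivity
  have hε₁1 : ε₁ ≤ 1 := min_le_left _ _
  have hε₁2 : p * (n * Λ * (ε₁ * B)) ≤ c / 3 := by
    have h1 : ε₁ ≤ c / 3 / ((p + 1) * n * Λ * B) := min_le_right _ _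
    rw [le_div_iff₀ (by positivity)] at h1
    have : 0 ≤ ε₁ * (n * Λ * B) := by positivity
    nlinarith
  set ε : ℝ := ε₁ ^ n / (4 * n) with hε
  have hε0 : 0 < ε := by positivity
  set β : ℝ := n * δ with hβ
  have hβ0 : 0 < β := by positivity
  set α : ℝ := 1 / β with hα
  have hα0 : 0 < α := by positivity
  set μ : ℝ := c / 3 / β
  have hμ : 0 < μ := by positivity
  obtain ⟨C₁, hC₁, ρ₁, hρ₁, hχ⟩ := exists_gevrey_cutoff n p
    (by positivity : 0 < c / 3 * ε ^ α) hα0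
  have hs : 1 + 1 / α = 1 + β := by rw [hα, one_div_one_div]
  rw [hs] at hχ
  refine ⟨C₁ * Real.exp 1, by positivity, ρ₁ + 2 * Real.exp 1 * ε⁻¹ * μ⁻¹ ^ β, by positivity,
    fun L hL η hη => ?_⟩
  have hL0 : 0 < L := by linarith
  set N := L ^ (1 / (1 + δ)) with hN
  have hN1 : 1 ≤ N := Real.one_le_rpow hL (by positivity)
  have hN0 : 0 < N := by linarith
  set l := L ^ (-(δ / (1 + δ))) with hl
  have hl0 : 0 < l := by positivity
  have hl1 : l ≤ 1 := Real.rpow_le_one_of_one_le_of_nonpos hL (by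
    have : 0 < δ / (1 + δ) := by positivity
    linarith)
  have hLl : L * l = N := by
    rw [hl, hN]
    nth_rewrite 1 [← Real.rpow_one L]
    rw [← Real.rpow_add hL0]; congr 1; field_simp; ring
  have hlN : l⁻¹ ^ n = N ^ β := by
    rw [hl, hN, ← Real.rpow_neg hL0.le, neg_neg, ← Real.rpow_natCast, ← Real.rpow_mul hL0.le,
      ← Real.rpow_mul hL0.le]
    congr 1; rw [hβ]; field_simp
  set r := ε * l ^ n with hr
  have hr0 : 0 < r := by positivity
  have hrinv : r⁻¹ = ε⁻¹ * N ^ β := by rw [hr, mul_inv, ← inv_pow, hlN]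
  have hrα : r ^ (-α) = (ε ^ α)⁻¹ * N := by
    rw [Real.rpow_neg hr0.le, ← Real.inv_rpow hr0.le, hrinv, Real.mul_rpow (by positivity)
      (by positivity), Real.inv_rpow hε0.le, ← Real.rpow_mul hN0.le, hα, mul_one_div_cancel hβ0.ne',
      Real.rpow_one]
  have h4r : 4 * r = ε₁ ^ n * l ^ n / n := by rw [hr, hε]; field_simp
  have h4r1 : 4 * r ≤ 1 := by
    rw [h4r, div_le_one hn0]
    have h1 : ε₁ ^ n * l ^ n ≤ 1 := mul_le_one₀ (pow_le_one₀ hε₁0.le hε₁1) (by positivity)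
      (pow_le_one₀ hl0.le hl1)
    have : (1 : ℝ) ≤ n := by exact_mod_cast hn
    linarith
  obtain ⟨χ, hχ1, hχ2, hχ3, hχ4⟩ := hχ r hr0 (by linarith)
    (theta n p '' Metric.closedBall 0 R)
  obtain ⟨T, hT1, hT2⟩ := exists_entire_prod_symmExp η
  refine ⟨fun a => χ a • T (ofRealPi n p a), hχ1.smul (contDiff_comp_ofRealPi hT1),
    fun x hx => ?_, fun a => ?_⟩
  · beta_reduce
    rw [hχ2 _ ⟨x, mem_closedBall_zero_iff.2 hx, rfl⟩, one_smul, ofRealPi_theta, hT2]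
    rfl
  by_cases ha : ∀ a₀ ∈ theta n p '' Metric.closedBall 0 R, 3 * r ≤ dist a a₀
  · refine (GevreyBoundAt.zero _ _ _ (by positivity) (by positivity) a).congr ?_
    filter_upwards [Metric.ball_mem_nhds a hr0] with y hy
    rw [hχ3 y fun a₀ h₀ => ?_, zero_smul]
    have := ha a₀ h₀
    rw [Metric.mem_ball'] at hy
    linarith [dist_triangle a y a₀]
  · push Not at ha
    obtain ⟨_, ⟨x, hx, rfl⟩, hax⟩ := ha
    rw [mem_closedBall_zero_iff] at hx
    have hM : ∀ z ∈ Metric.closedBall (ofRealPi n p a) r, ‖T z‖ ≤ Real.exp (c / 3 * N) := by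
      intro z hz
      refine (norm_le_of_near_theta hT2 (B := B) (b := ε₁ * B * l) (r := 4 * r) (x := x)
        (by omega) (by positivity) ?_ ?_ ?_).trans (Real.exp_le_exp.2 ?_)
      · have := hS' x hx
        rw [hB]; gcongr
      · rw [h4r, mul_pow, mul_pow]
        exact le_of_eq (by field_simp)
      · rw [Metric.mem_closedBall, dist_eq_norm] at hz
        rw [dist_eq_norm, ← norm_ofRealPi_apply, map_sub] at hax
        have := norm_sub_le_norm_sub_add_norm_sub z (ofRealPi n p a) (ofRealPi n p (theta n p x))
        linarith
      · calc p * (n * ‖η‖ * (ε₁ * B * l)) ≤ p * (n * (Λ * L) * (ε₁ * B * l)) := by gcongr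
          _ = p * (n * Λ * (ε₁ * B)) * (L * l) := by ring
          _ ≤ c / 3 * N := by rw [hLl]; gcongr
    have hg := gevreyBoundAt_comp_ofRealPi hT1 hβ0 hμ hε0 hN0 hrinv hM
    have := (hχ4 a).smul (by positivity) hg (by positivity) (by positivity) hρ₁.le (by positivity)
      hχ1 (contDiff_comp_ofRealPi hT1)
    refine this.mono (by positivity) (by positivity) (le_of_eq ?_) le_rfl
    rw [hrα, show c / 3 * ε ^ α * ((ε ^ α)⁻¹ * N) = c / 3 * N by field_simp,
      show μ * β = c / 3 from div_mul_cancel₀ _ hβ0.ne']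
    have : Real.exp (c * N) = Real.exp (c / 3 * N) * Real.exp (c / 3 * N) *
        Real.exp (c / 3 * N) := by
      rw [← Real.exp_add, ← Real.exp_add]; congr 1; ring
    rw [this]; ring

end Extension

section Fourier

variable {ι : Type*} [Fintype ι]

theorem summable_prod_pi {κ : Type*} {u : κ → ℝ} (hu : Summable u) (hu0 : ∀ m, 0 ≤ u m) :
    Summable fun ξ : ι → κ => ∏ i, u (ξ i) := by
  classical
  refine summable_of_sum_le (c := ∏ _i : ι, ∑' m, u m)
    (fun ξ => Finset.prod_nonneg fun i _ => hu0 _) fun S => ?_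
  calc ∑ ξ ∈ S, ∏ i, u (ξ i)
      ≤ ∑ ξ ∈ Fintype.piFinset fun i => S.image fun ξ => ξ i, ∏ i, u (ξ i) := by
        refine Finset.sum_le_sum_of_subset_of_nonneg (fun ξ hξ => ?_) fun ξ _ _ =>
          Finset.prod_nonneg fun i _ => hu0 _
        exact Fintype.mem_piFinset.2 fun i => Finset.mem_image_of_mem _ hξ
    _ = ∏ i, ∑ m ∈ S.image fun ξ => ξ i, u m := (Finset.prod_univ_sum _ _).symm
    _ ≤ _ := Finset.prod_le_prod (fun i _ => Finset.sum_nonneg fun m _ => hu0 m)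
        fun i _ => hu.sum_le_tsum _ fun m _ => hu0 m

theorem summable_exp_neg_mul_rpow {c a : ℝ} (hc : 0 < c) (ha : 0 < a) :
    Summable fun ξ : ι → ℤ => Real.exp (-(c * max 1 ‖ξ‖ ^ a)) := by
  have hu : Summable fun m : ℤ => (1 + (m : ℝ) ^ 2)⁻¹ := by
    refine Summable.of_norm_bounded_eventually (Real.summable_one_div_int_pow.2 one_lt_two) ?_
    filter_upwards [Filter.eventually_cofinite_ne 0] with m hm
    have : (0 : ℝ) < (m : ℝ) ^ 2 := by positivity
    rw [Real.norm_of_nonneg (by positivity), one_div]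
    gcongr
    linarith
  obtain ⟨k, hk⟩ := exists_nat_ge (2 * Fintype.card ι / a)
  rw [div_le_iff₀ ha] at hk
  refine Summable.of_nonneg_of_le (fun _ => (Real.exp_pos _).le) (fun ξ => ?_)
    ((summable_prod_pi (ι := ι) hu fun m => by positivity).mul_left
      (k ! * c⁻¹ ^ k * 2 ^ Fintype.card ι))
  set L := max 1 ‖ξ‖ with hL
  have hL1 : 1 ≤ L := le_max_left _ _
  have hL0 : 0 < L := by linarith
  have h1 := pow_le_factorial_mul_exp hc (by positivity : 0 ≤ L ^ a) k
  have h2 : ∏ i, (1 + (ξ i : ℝ) ^ 2) ≤ 2 ^ Fintype.card ι * (L ^ a) ^ k := by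
    calc ∏ i, (1 + (ξ i : ℝ) ^ 2) ≤ ∏ _i : ι, 2 * L ^ 2 := by
          refine Finset.prod_le_prod (fun _ _ => by positivity) fun i _ => ?_
          have : |(ξ i : ℝ)| ≤ L :=
            ((Int.norm_eq_abs _).symm.le.trans (norm_le_pi_norm ξ i)).trans (le_max_right _ _)
          nlinarith [sq_abs (ξ i : ℝ), abs_nonneg (ξ i : ℝ)]
      _ = 2 ^ Fintype.card ι * L ^ ((2 * Fintype.card ι : ℕ) : ℝ) := by
          rw [Finset.prod_const, Finset.card_univ, mul_pow, ← pow_mul, ← Real.rpow_natCast L]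
      _ ≤ _ := by
          rw [← Real.rpow_natCast (L ^ a), ← Real.rpow_mul hL0.le]
          gcongr
          push_cast; linarith
  rw [Finset.prod_inv_distrib, ← div_eq_mul_inv, le_div_iff₀ (Finset.prod_pos fun _ _ =>
      by positivity),
    Real.exp_neg, inv_mul_le_iff₀ (Real.exp_pos _)]
  calc _ ≤ 2 ^ Fintype.card ι * (k ! * c⁻¹ ^ k * Real.exp (c * L ^ a)) := h2.trans (by gcongr)
    _ = _ := by ring

theorem norm_fwdDiff_iter_le {E F : Type*} [NormedAddCommGroup E] [NormedSpace ℝ E]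
    [NormedAddCommGroup F] [NormedSpace ℝ F] (v : E) (k : ℕ) {M : ℝ} {G : E → F}
    (hG : ContDiff ℝ (⊤ : ℕ∞) G) (hM : ∀ y, ‖iteratedFDeriv ℝ k G y‖ ≤ M) (y : E) :
    ‖(fwdDiff v)^[k] G y‖ ≤ M * ‖v‖ ^ k := by
  induction k generalizing G M with
  | zero => simpa using hM y
  | succ k ih =>
    rw [Function.iterate_succ_apply, pow_succ', ← mul_assoc]
    have hd : ContDiff ℝ (⊤ : ℕ∞) fun x => G (x + v) := hG.comp (contDiff_id.add contDiff_const)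
    refine ih (hd.sub hG) fun x => ?_
    change ‖iteratedFDeriv ℝ k (fun x => G (x + v) - G x) x‖ ≤ _
    rw [fun_iteratedFDeriv_sub_apply (hd.of_le (by exact_mod_cast le_top)).contDiffAt
      (hG.of_le (by exact_mod_cast le_top)).contDiffAt, iteratedFDeriv_comp_add_right]
    have := Convex.norm_image_sub_le_of_norm_fderiv_le (𝕜 := ℝ) (f := iteratedFDeriv ℝ k G)
      (s := Set.univ) (x := x) (y := x + v) (C := M)
      (fun z _ => (hG.differentiable_iteratedFDeriv (by exact_mod_cast ENat.natCast_lt_top k)) z)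
      (fun z _ => by rw [norm_fderiv_iteratedFDeriv]; exact hM z) convex_univ trivial trivial
    simpa using this

theorem exists_exp_bound_of_forall_pow {s C ρ : ℝ} (hs : 0 < s) (hρ : 0 < ρ) (hC : 0 ≤ C) :
    ∀ L : ℝ, 0 < L → ∀ a : ℝ, (∀ k : ℕ, a ≤ C * (ρ / L) ^ k * (k ! : ℝ) ^ s) →
      a ≤ C * Real.exp s *
        Real.exp (-(s * ρ⁻¹ ^ (1 / s) * Real.exp (-1) * L ^ (1 / s))) := by
  intro L hL a h
  set u := (ρ⁻¹ * L) ^ (1 / s) with hu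
  have hu0 : 0 < u := by positivity
  set k := ⌊u * Real.exp (-1)⌋₊ with hk
  have hk1 : (k : ℝ) ≤ u * Real.exp (-1) := Nat.floor_le (by positivity)
  have hk2 : u * Real.exp (-1) < k + 1 := Nat.lt_floor_add_one _
  have hus : u ^ s = (ρ / L)⁻¹ := by
    rw [hu, ← Real.rpow_mul (by positivity), one_div_mul_cancel hs.ne', Real.rpow_one, inv_div,
      div_eq_inv_mul]
  have h1 : (k ! : ℝ) ^ s ≤ (ρ / L)⁻¹ ^ k * Real.exp (-s * k) := by
    calc (k ! : ℝ) ^ s ≤ ((u * Real.exp (-1)) ^ k) ^ s := by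
          gcongr
          calc (k ! : ℝ) ≤ (k : ℝ) ^ k := by exact_mod_cast Nat.factorial_le_pow k
            _ ≤ _ := by gcongr
      _ = (u ^ s * Real.exp (-s)) ^ k := by
          rw [← Real.rpow_natCast, ← Real.rpow_mul (by positivity), mul_comm (k : ℝ),
            Real.rpow_mul (by positivity), Real.rpow_natCast, Real.mul_rpow hu0.le (by positivity),
            ← Real.exp_mul]
          congr 3; ring
      _ = _ := by rw [mul_pow, hus, ← Real.exp_nat_mul]; congr 2; ring
  calc a ≤ _ := h k
    _ ≤ C * (ρ / L) ^ k * ((ρ / L)⁻¹ ^ k * Real.exp (-s * k)) := by gcongr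
    _ = C * Real.exp (-s * k) := by
        rw [inv_pow]; field_simp
    _ ≤ C * Real.exp (s + -(s * (u * Real.exp (-1)))) := by
        gcongr
        nlinarith
    _ = _ := by
        rw [Real.exp_add, hu, Real.mul_rpow (by positivity) hL.le]
        ring_nf

end Fourier

section FourierCoeff

open UnitAddTorus MeasureTheory

variable {ι : Type*}

/-- The periodic extension of the restriction of `g` to the unit cube centred at the origin. -/
noncomputable def periodize (g : (ι → ℝ) → ℂ) (y : ι → ℝ) : ℂ := g fun i => y i - round (y i)

theorem periodize_add_intCast (g : (ι → ℝ) → ℂ) (y : ι → ℝ) (m : ι → ℤ) :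
    periodize g (fun i => y i + m i) = periodize g y := by
  simp [periodize]

theorem exists_continuous_torus_lift {g : (ι → ℝ) → ℂ} (hg : Continuous (periodize g)) :
    ∃ G : C(UnitAddTorus ι, ℂ), ∀ y : ι → ℝ, G (fun i => (y i : UnitAddCircle)) =
        periodize g y := by
  have hq : IsOpenQuotientMap (Pi.map fun (_ : ι) (y : ℝ) => (y : UnitAddCircle)) :=
    IsOpenQuotientMap.piMap fun _ => QuotientAddGroup.isOpenQuotientMap_mk
  have hG : ∀ y : ι → ℝ, periodize g (Function.surjInv hq.surjective
      (Pi.map (fun _ (y : ℝ) => (y : UnitAddCircle)) y)) = periodize g y := by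
    intro y
    set z := Function.surjInv hq.surjective (Pi.map (fun _ (y : ℝ) => (y : UnitAddCircle)) y)
        with hz
    have h : ∀ i, ∃ m : ℤ, y i + m = z i := fun i => by
      have h1 : ((z i : ℝ) : UnitAddCircle) = y i :=
        congrFun (Function.surjInv_eq hq.surjective
          (Pi.map (fun _ (y : ℝ) => (y : UnitAddCircle)) y)) i
      obtain ⟨m, hm⟩ := (AddCircle.coe_eq_zero_iff 1 (x := z i - y i)).1 (by
        rw [AddCircle.coe_sub, h1, sub_self])
      exact ⟨m, by simp at hm; linarith⟩
    choose m hm using h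
    rw [← periodize_add_intCast g y m]
    exact congrArg _ (funext fun i => (hm i).symm)
  refine ⟨⟨fun t => periodize g (Function.surjInv hq.surjective t), ?_⟩, hG⟩
  rw [hq.isQuotientMap.continuous_iff]
  exact hg.congr fun y => (hG y).symm

variable [Fintype ι]

theorem mFourier_add_apply (ξ : ι → ℤ) (x y : UnitAddTorus ι) :
    mFourier ξ (x + y) = mFourier ξ x * mFourier ξ y := by
  simp only [mFourier, ContinuousMap.coe_mk, Pi.add_apply, fourier_apply, smul_add,
    AddCircle.toCircle_add, Circle.coe_mul, Finset.prod_mul_distrib]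

theorem mFourierCoeff_eq_integral_pi (G : UnitAddTorus ι → ℂ) (ξ : ι → ℤ) :
    mFourierCoeff G ξ =
      ∫ t, mFourier (-ξ) t • G t ∂(Measure.pi fun _ : ι => AddCircle.haarAddCircle) := rfl

theorem mFourierCoeff_fwdDiff {G : UnitAddTorus ι → ℂ} (hG : Continuous G) (ξ : ι → ℤ)
    (τ : UnitAddTorus ι) :
    mFourierCoeff (fwdDiff τ G) ξ = (mFourier ξ τ - 1) * mFourierCoeff G ξ := by
  simp only [mFourierCoeff_eq_integral_pi, fwdDiff, smul_sub]
  have hi : ∀ H : UnitAddTorus ι → ℂ, Continuous H →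
      Integrable H (Measure.pi fun _ : ι => AddCircle.haarAddCircle) := fun H hH =>
    hH.integrable_of_hasCompactSupport (HasCompactSupport.of_compactSpace H)
  rw [integral_sub (hi _ (by fun_prop)) (hi _ (by fun_prop)), sub_mul, one_mul]
  congr 1
  have h := integral_add_right_eq_self
    (μ := Measure.pi fun _ : ι => (AddCircle.haarAddCircle : Measure UnitAddCircle))
    (fun t => mFourier (-ξ) (t - τ) • G t) τ
  simp only [add_sub_cancel_right] at h
  rw [h, ← integral_const_mul]
  refine integral_congr_ae (Filter.Eventually.of_forall fun t => ?_)
  have h1 : mFourier (-ξ) (t - τ) * mFourier (-ξ) τ = mFourier (-ξ) t := by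
    rw [← mFourier_add_apply, sub_add_cancel]
  have h2 : mFourier (-ξ) τ * mFourier ξ τ = 1 := by
    rw [← mFourier_add, neg_add_cancel, mFourier_zero]; rfl
  simp only [smul_eq_mul]
  rw [← h1]
  linear_combination (-mFourier (-ξ) (t - τ) * G t) * h2

theorem norm_mFourierCoeff_le (G : UnitAddTorus ι → ℂ) {B : ℝ} (ξ : ι → ℤ) (hB : ∀ t, ‖G t‖ ≤ B) :
    ‖mFourierCoeff G ξ‖ ≤ B := by
  rw [mFourierCoeff_eq_integral_pi]
  refine (norm_integral_le_of_norm_le_const (C := B) (Filter.Eventually.of_forall fun t =>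
      ?_)).trans
    (by simp)
  rw [norm_smul]
  have := (mFourier (-ξ)).norm_coe_le_norm t
  rw [mFourier_norm] at this
  exact (mul_le_of_le_one_left (norm_nonneg _) this).trans (hB t)

theorem norm_mFourierCoeff_le_of_fwdDiff {ξ : ι → ℤ} {τ : UnitAddTorus ι} (hτ : mFourier ξ τ = -1)
    (k : ℕ) {B : ℝ} {G : UnitAddTorus ι → ℂ} (hG : Continuous G)
    (hB : ∀ t, ‖(fwdDiff τ)^[k] G t‖ ≤ B) : ‖mFourierCoeff G ξ‖ ≤ B := by
  induction k generalizing G with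
  | zero => exact norm_mFourierCoeff_le G ξ hB
  | succ k ih =>
    have h := ih (G := fwdDiff τ G) ((hG.comp (by fun_prop : Continuous fun t => t + τ)).sub hG) hB
    rw [mFourierCoeff_fwdDiff hG, hτ, norm_mul] at h
    norm_num at h
    linarith [norm_nonneg (mFourierCoeff G ξ)]

theorem periodize_eventuallyEq {g : (ι → ℝ) → ℂ} (hg : ∀ x, 1 / 4 ≤ ‖x‖ → g x = 0) (y : ι → ℝ) :
    (∃ m : ι → ℝ, periodize g =ᶠ[nhds y] fun x => g (x + m)) ∨ periodize g =ᶠ[nhds y] 0 := by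
  by_cases h : ∀ i, |y i - round (y i)| < 1 / 2
  · refine .inl ⟨fun i => -round (y i), ?_⟩
    have : ∀ i, ∀ᶠ x : ι → ℝ in nhds y, |x i - round (y i)| < 1 / 2 := fun i =>
      ((continuous_apply i).sub continuous_const).abs.continuousAt.eventually_lt_const (h i)
    filter_upwards [Filter.eventually_all.2 this] with x hx
    have hr : ∀ i, round (x i) = round (y i) := fun i => by
      have := abs_lt.1 (hx i)
      rw [round_eq, Int.floor_eq_iff]
      constructor <;> linarith
    simp only [periodize, hr]
    rfl
  · push Not at h
    obtain ⟨i, hi⟩ := h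
    refine .inr ?_
    have hc : Continuous fun x : ι → ℝ => ‖((x i : ℝ) : UnitAddCircle)‖ :=
      ((AddCircle.continuous_mk' 1).comp (continuous_apply i)).norm
    have : ∀ᶠ x : ι → ℝ in nhds y, 1 / 4 < ‖((x i : ℝ) : UnitAddCircle)‖ := by
      refine hc.continuousAt.eventually_const_lt ?_
      beta_reduce
      rw [UnitAddCircle.norm_eq]; linarith
    filter_upwards [this] with x hx
    rw [UnitAddCircle.norm_eq] at hx
    exact hg _ (hx.le.trans (norm_le_pi_norm (fun i => x i - round (x i)) i))

theorem contDiff_periodize {g : (ι → ℝ) → ℂ} (hg : ∀ x, 1 / 4 ≤ ‖x‖ → g x = 0)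
    (hg' : ContDiff ℝ (⊤ : ℕ∞) g) : ContDiff ℝ (⊤ : ℕ∞) (periodize g) := by
  refine contDiff_iff_contDiffAt.2 fun y => ?_
  obtain ⟨m, h⟩ | h := periodize_eventuallyEq hg y
  · exact (hg'.comp (contDiff_id.add contDiff_const)).contDiffAt.congr_of_eventuallyEq h
  · exact contDiffAt_const.congr_of_eventuallyEq h

theorem norm_iteratedFDeriv_periodize_le {g : (ι → ℝ) → ℂ} (hg : ∀ x, 1 / 4 ≤ ‖x‖ → g x = 0)
    {k : ℕ} {M : ℝ} (hM : ∀ y, ‖iteratedFDeriv ℝ k g y‖ ≤ M) (y : ι → ℝ) :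
    ‖iteratedFDeriv ℝ k (periodize g) y‖ ≤ M := by
  obtain ⟨m, h⟩ | h := periodize_eventuallyEq hg y
  · rw [(h.iteratedFDeriv ℝ k).eq_of_nhds, iteratedFDeriv_comp_add_right]
    exact hM _
  · rw [(h.iteratedFDeriv ℝ k).eq_of_nhds, show (0 : (ι → ℝ) → ℂ) = fun _ => 0 from rfl,
      iteratedFDeriv_fun_zero]
    simpa using (norm_nonneg _).trans (hM y)

theorem mFourier_coe_apply (ξ : ι → ℤ) (y : ι → ℝ) :
    mFourier ξ (fun i => (y i : UnitAddCircle)) =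
      Complex.exp (Complex.I * ∑ i, (2 * Real.pi * ξ i * y i : ℝ)) := by
  simp only [mFourier, ContinuousMap.coe_mk, fourier_coe_apply]
  rw [← Complex.exp_sum]
  push_cast
  rw [Finset.mul_sum]
  refine congrArg _ (Finset.sum_congr rfl fun i _ => ?_)
  ring

theorem exists_hasSum_exp_of_gevreyBoundAt {g : (ι → ℝ) → ℂ} (hg : ContDiff ℝ (⊤ : ℕ∞) g)
    (hg0 : ∀ x, 1 / 4 ≤ ‖x‖ → g x = 0) {s C ρ : ℝ} (hs : 0 < s) (hC : 0 < C) (hρ : 1 ≤ ρ)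
    (hgs : ∀ x, GevreyBoundAt s C ρ g x) :
    ∃ c : (ι → ℤ) → ℂ, ∃ A : ℝ, 0 < A ∧ ∃ κ : ℝ, 0 < κ ∧
      (∀ ξ, ‖c ξ‖ ≤ A * Real.exp (-(κ * max 1 ‖ξ‖ ^ (1 / s)))) ∧
      ∀ x, ‖x‖ ≤ 1 / 4 → HasSum (fun ξ => c ξ *
        Complex.exp (Complex.I * ∑ i, (2 * Real.pi * ξ i * x i : ℝ))) (g x) := by
  classical
  have hρ0 : 0 < ρ := by linarith
  have hp := contDiff_periodize hg0 hg
  obtain ⟨G, hG⟩ := exists_continuous_torus_lift hp.continuous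
  have hsurj : ∀ t : UnitAddTorus ι, ∃ y : ι → ℝ, (fun i => (y i : UnitAddCircle)) =
      t := fun t => by
    choose y hy using fun i => QuotientAddGroup.mk_surjective (t i)
    exact ⟨y, funext hy⟩
  have hdecay : ∀ ξ, ∀ k : ℕ, ‖mFourierCoeff G ξ‖ ≤ C * (ρ / max 1 ‖ξ‖) ^ k * (k ! : ℝ) ^ s := by
    intro ξ k
    rcases eq_or_ne ξ 0 with rfl | hξ
    · refine (norm_mFourierCoeff_le G (B := C) 0 fun t => ?_).trans ?_
      · obtain ⟨y, rfl⟩ := hsurj t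
        rw [hG, periodize]
        simpa using hgs (fun i => y i - round (y i)) 0
      · have h1 : 1 ≤ (ρ / max 1 ‖(0 : ι → ℤ)‖) ^ k := by simpa using one_le_pow₀ hρ
        have h2 : 1 ≤ (k ! : ℝ) ^ s :=
          Real.one_le_rpow (by exact_mod_cast Nat.one_le_iff_ne_zero.2 k.factorial_ne_zero) hs.le
        nlinarith [mul_nonneg hC.le (sub_nonneg.2 h1), one_le_mul_of_one_le_of_one_le h1 h2]
    obtain ⟨i, hi⟩ : ∃ i, ‖ξ i‖ = ‖ξ‖ := by
      have : Nonempty ι := by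
        obtain ⟨i, -⟩ := Function.ne_iff.1 hξ
        exact ⟨i⟩
      obtain ⟨i, -, hi⟩ := Finset.exists_mem_eq_sup' Finset.univ_nonempty fun i => ‖ξ i‖
      refine ⟨i, le_antisymm (norm_le_pi_norm ξ i) ((pi_norm_le_iff_of_nonneg (norm_nonneg _)).2
        fun j => ?_)⟩
      rw [← hi]
      exact Finset.le_sup' (fun i => ‖ξ i‖) (Finset.mem_univ j)
    have hξi : ξ i ≠ 0 := by
      rw [← norm_ne_zero_iff, hi, norm_ne_zero_iff]; exact hξ
    have hξi' : (ξ i : ℝ) ≠ 0 := by exact_mod_cast hξi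
    have hL : max 1 ‖ξ‖ = |(ξ i : ℝ)| := by
      rw [← hi, Int.norm_eq_abs, max_eq_right]
      exact_mod_cast Int.one_le_abs hξi
    set v : ι → ℝ := Pi.single i (2 * ξ i : ℝ)⁻¹ with hv
    have hvn : ‖v‖ ≤ (max 1 ‖ξ‖)⁻¹ := by
      rw [hv, Pi.norm_single, hL, norm_inv, norm_mul, Real.norm_ofNat, Real.norm_eq_abs]
      have : 0 < |(ξ i : ℝ)| := abs_pos.2 hξi'
      gcongr
      linarith
    have hτ : mFourier ξ (fun j => (v j : UnitAddCircle)) = -1 := by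
      rw [mFourier_coe_apply, Finset.sum_eq_single i (fun j _ hj => by simp [hv, hj]) (by simp),
        ← Complex.exp_pi_mul_I]
      congr 1
      rw [hv, Pi.single_eq_same, mul_comm]
      congr 2
      field_simp
    have hiter : ∀ (m : ℕ) (y : ι → ℝ), (fwdDiff fun j => (v j : UnitAddCircle))^[m] G
        (fun j => (y j : UnitAddCircle)) = (fwdDiff v)^[m] (periodize g) y := by
      intro m
      induction m with
      | zero => exact hG
      | succ m ih =>
        intro y
        rw [Function.iterate_succ_apply', Function.iterate_succ_apply', fwdDiff, fwdDiff, ← ih,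
            ← ih]
        rfl
    refine norm_mFourierCoeff_le_of_fwdDiff hτ k G.continuous fun t => ?_
    obtain ⟨y, rfl⟩ := hsurj t
    rw [hiter]
    refine (norm_fwdDiff_iter_le v k hp (norm_iteratedFDeriv_periodize_le hg0 fun y => hgs y k)
      y).trans ?_
    calc C * ρ ^ k * (k ! : ℝ) ^ s * ‖v‖ ^ k ≤ C * ρ ^ k * (k ! : ℝ) ^ s * (max 1 ‖ξ‖)⁻¹ ^ k := by
          gcongr
      _ = _ := by rw [div_pow, inv_pow]; ring
  have hbound := fun ξ => exists_exp_bound_of_forall_pow hs hρ0 hC.le (max 1 ‖ξ‖) (by positivity) _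
    (hdecay ξ)
  refine ⟨mFourierCoeff G, C * Real.exp s, by positivity, s * ρ⁻¹ ^ (1 / s) * Real.exp (-1),
    by positivity, hbound, fun x hx => ?_⟩
  have hsum : Summable (mFourierCoeff G) := by
    refine .of_norm_bounded ((summable_exp_neg_mul_rpow (ι := ι)
      (c := s * ρ⁻¹ ^ (1 / s) * Real.exp (-1)) (a := 1 / s)
      (by positivity) (by positivity)).mul_left (C * Real.exp s)) hbound
  have h := hasSum_mFourier_series_apply_of_summable hsum fun i => (x i : UnitAddCircle)
  simp only [mFourier_coe_apply, smul_eq_mul] at h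
  rw [hG, periodize] at h
  convert h using 2
  ext i
  have h1 := abs_le.1 ((norm_le_pi_norm x i).trans hx)
  have : round (x i) = 0 := by
    rw [round_eq, Int.floor_eq_iff]
    constructor <;> push_cast <;> linarith
  simp [this]

end FourierCoeff

section Expansion

variable {n p : ℕ}

theorem exists_exp_expansion {δ : ℝ} (hδ : 0 < δ) {f : (Fin p → Fin n → ℝ) → ℝ}
    (hf : ContDiff ℝ (⊤ : ℕ∞) f)
    (hfG : ∀ K : Set (Fin p → Fin n → ℝ), IsCompact K →
      ∃ C > (0 : ℝ), ∃ ρ > (0 : ℝ), ∀ x ∈ K, GevreyBoundAt (1 + δ) C ρ f x)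
    {R : ℝ} (hR : 0 ≤ R) :
    ∃ Λ : ℝ, 0 < Λ ∧ ∃ c : (Fin p × Fin n → ℤ) → ℂ, ∃ A : ℝ, 0 < A ∧ ∃ κ : ℝ, 0 < κ ∧
      (∀ ξ, ‖c ξ‖ ≤ A * Real.exp (-(κ * max 1 ‖ξ‖ ^ (1 / (1 + δ))))) ∧
      ∀ x : Fin p → Fin n → ℝ, ‖x‖ ≤ R → HasSum (fun ξ => c ξ *
        Complex.exp (Complex.I * ∑ q : Fin p × Fin n, (Λ * ξ q * x q.1 q.2 : ℝ))) (f x : ℂ) := by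
  obtain ⟨C₁, hC₁, ρ₁, hρ₁, hχ⟩ := exists_gevrey_cutoff n p (α := 1 / δ) one_pos (by positivity)
  obtain ⟨χ, hχ1, hχ2, hχ3, hχ4⟩ := hχ (1 / 2) (by norm_num) (by norm_num) (Metric.closedBall 0 R)
  rw [one_div_one_div] at hχ4
  set C₃ := C₁ * Real.exp (1 * (1 / 2) ^ (-(1 / δ))) with hC₃
  have hC₃0 : 0 < C₃ := by positivity
  obtain ⟨C₂, hC₂, ρ₂, hρ₂, hf2⟩ := hfG _ (isCompact_closedBall (0 : Fin p → Fin n → ℝ) (R + 1))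
  have hχ0 : ∀ x, R + 1 ≤ ‖x‖ → χ x = 0 := fun x hx => hχ3 x fun a ha => by
    rw [mem_closedBall_zero_iff] at ha
    have := norm_sub_norm_le x a
    rw [dist_eq_norm]; linarith
  obtain ⟨C, hC, ρ, hρ, h⟩ : ∃ C : ℝ, 0 < C ∧ ∃ ρ : ℝ, 0 < ρ ∧
      ∀ x, GevreyBoundAt (1 + δ) C ρ (fun x => χ x • f x) x := by
    refine ⟨C₃ * C₂, mul_pos hC₃0 hC₂, ρ₁ + ρ₂, add_pos hρ₁ hρ₂, fun x => ?_⟩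
    by_cases hx : ‖x‖ ≤ R + 1
    · exact (hχ4 x).smul (by positivity) (hf2 x (mem_closedBall_zero_iff.2 hx)) (by positivity)
        hC₂.le hρ₁.le hρ₂.le hχ1 hf
    · push Not at hx
      refine (GevreyBoundAt.zero _ _ _ (by positivity) (by positivity) x).congr ?_
      filter_upwards [continuous_norm.continuousAt.eventually_const_lt hx] with y hy
      rw [hχ0 y hy.le, zero_smul]
  set a : ℝ := 4 * (R + 1) with ha
  have ha0 : 0 < a := by positivity
  let T : (Fin p × Fin n → ℝ) →L[ℝ] (Fin p → Fin n → ℝ) :=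
    ContinuousLinearMap.pi fun j => ContinuousLinearMap.pi fun i =>
      a • ContinuousLinearMap.proj (j, i)
  have hT : ∀ y j i, T y j i = a * y (j, i) := fun y j i => rfl
  have hfc : ContDiff ℝ (⊤ : ℕ∞) fun x => χ x • f x := hχ1.smul hf
  have hg := fun y => ((h (T y)).comp_clm T hfc).clm_comp Complex.ofRealCLM
    (hfc.comp T.contDiff)
  have hTn : ∀ y, 1 / 4 ≤ ‖y‖ → R + 1 ≤ ‖T y‖ := fun y hy => by
    have h1 : ‖y‖ ≤ a⁻¹ * ‖T y‖ := by
      refine (pi_norm_le_iff_of_nonneg (by positivity)).2 fun q => ?_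
      have h2 := (norm_le_pi_norm (T y q.1) q.2).trans (norm_le_pi_norm (T y) q.1)
      rw [hT, norm_mul, Real.norm_of_nonneg ha0.le] at h2
      rw [inv_mul_eq_div, le_div_iff₀ ha0]; linarith
    rw [inv_mul_eq_div, le_div_iff₀ ha0] at h1
    nlinarith
  obtain ⟨c, A, hA, κ, hκ, hc1, hc2⟩ := exists_hasSum_exp_of_gevreyBoundAt
    (g := fun y => Complex.ofRealCLM (χ (T y) • f (T y)))
    (Complex.ofRealCLM.contDiff.comp (hfc.comp T.contDiff))
    (fun y hy => by simp [hχ0 _ (hTn y hy)]) (s := 1 + δ) (C := (‖Complex.ofRealCLM‖ + 1) * C)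
    (ρ := ρ * ‖T‖ + 1) (by positivity) (by positivity)
    (by nlinarith [norm_nonneg T])
    (fun y => (hg y).mono (by positivity) (by positivity) (by nlinarith) (by linarith))
  refine ⟨2 * Real.pi / a, by positivity, c, A, hA, κ, hκ, hc1, fun x hx => ?_⟩
  have hx' : T (fun q => a⁻¹ * x q.1 q.2) = x := by
    ext j i; rw [hT]; field_simp
  have := hc2 (fun q => a⁻¹ * x q.1 q.2) ?_
  · rw [hx', hχ2 x (mem_closedBall_zero_iff.2 hx), one_smul] at this
    have e : ∀ ξ : Fin p × Fin n → ℤ, ∑ q, 2 * Real.pi / a * ξ q * x q.1 q.2 =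
        ∑ q, 2 * Real.pi * ξ q * (a⁻¹ * x q.1 q.2) := fun ξ =>
      Finset.sum_congr rfl fun q _ => by ring
    simp only [e]
    exact this
  · refine (pi_norm_le_iff_of_nonneg (by positivity)).2 fun q => ?_
    have h2 := ((norm_le_pi_norm (x q.1) q.2).trans (norm_le_pi_norm x q.1)).trans hx
    rw [norm_mul, norm_inv, Real.norm_of_nonneg ha0.le, inv_mul_le_iff₀ ha0]
    linarith

theorem hasSum_prod_symmExp {f : (Fin p → Fin n → ℝ) → ℝ}
    (hinv : ∀ π : Fin p → Equiv.Perm (Fin n), ∀ x : Fin p → Fin n → ℝ,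
      f (fun j i => x j (π j i)) = f x)
    {c : (Fin p × Fin n → ℤ) → ℂ} {Λ R : ℝ} (hR : 0 ≤ R)
    (h : ∀ x : Fin p → Fin n → ℝ, ‖x‖ ≤ R → HasSum (fun ξ => c ξ *
        Complex.exp (Complex.I * ∑ q : Fin p × Fin n, (Λ * ξ q * x q.1 q.2 : ℝ))) (f x : ℂ))
    {x : Fin p → Fin n → ℝ} (hx : ‖x‖ ≤ R) :
    HasSum (fun ξ => c ξ * ∏ j, symmExp (fun i => Λ * ξ (j, i)) (fun i => (x j i : ℂ)))
      (f x : ℂ) := by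
  have hw : ∀ w : Fin p → Equiv.Perm (Fin n), ‖fun j i => x j (w j i)‖ ≤ R := fun w =>
    (pi_norm_le_iff_of_nonneg hR).2 fun j => (pi_norm_le_iff_of_nonneg hR).2 fun i =>
      ((norm_le_pi_norm (x j) _).trans (norm_le_pi_norm x j)).trans hx
  have hs := (hasSum_sum fun w (_ : w ∈ Finset.univ) => h _ (hw w)).mul_left (((n ! : ℂ)⁻¹) ^ p)
  have hn : (n ! : ℂ) ≠ 0 := by exact_mod_cast n.factorial_ne_zero
  have e1 : ∀ ξ : Fin p × Fin n → ℤ,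
      c ξ * ∏ j, symmExp (fun i => Λ * ξ (j, i)) (fun i => (x j i : ℂ)) =
      (n ! : ℂ)⁻¹ ^ p * ∑ w : Fin p → Equiv.Perm (Fin n), c ξ * Complex.exp
        (Complex.I * ∑ q : Fin p × Fin n, (Λ * ξ q * x q.1 (w q.1 q.2) : ℝ)) := fun ξ => by
    simp only [symmExp]
    rw [Finset.prod_mul_distrib, Finset.prod_const, Finset.card_univ, Fintype.card_fin,
      Finset.prod_univ_sum, Fintype.piFinset_univ, ← Finset.mul_sum, mul_left_comm]
    congr 2
    refine Finset.sum_congr rfl fun w _ => ?_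
    rw [← Complex.exp_sum, ← Finset.mul_sum, Fintype.sum_prod_type]
    push_cast
    rfl
  have e2 : (f x : ℂ) = (n ! : ℂ)⁻¹ ^ p *
      ∑ w : Fin p → Equiv.Perm (Fin n), (f (fun j i => x j (w j i)) : ℂ) := by
    simp only [hinv, Finset.sum_const, Finset.card_univ, Fintype.card_pi, Fintype.card_perm,
      Fintype.card_fin, Finset.prod_const, nsmul_eq_mul, Nat.cast_pow]
    rw [← mul_assoc, ← mul_pow, inv_mul_cancel₀ hn, one_pow, one_mul]
  rw [e2]
  simp only [e1]
  exact hs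

end Expansion

section Gluing

/-- `f` is smooth with Gevrey bounds of order `s` that are uniform on the whole space. -/
def UniformlyGevrey {E F : Type*} [NormedAddCommGroup E] [NormedSpace ℝ E]
    [NormedAddCommGroup F] [NormedSpace ℝ F] (s : ℝ) (f : E → F) : Prop :=
  ContDiff ℝ (⊤ : ℕ∞) f ∧ ∃ C : ℝ, 0 < C ∧ ∃ ρ : ℝ, 0 < ρ ∧ ∀ x, GevreyBoundAt s C ρ f x

namespace UniformlyGevrey

variable {E F G : Type*} [NormedAddCommGroup E] [NormedSpace ℝ E] [NormedAddCommGroup F]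
  [NormedSpace ℝ F] [NormedAddCommGroup G] [NormedSpace ℝ G] {s : ℝ}

theorem add {f g : E → F} (hf : UniformlyGevrey s f) (hg : UniformlyGevrey s g) :
    UniformlyGevrey s fun x => f x + g x := by
  obtain ⟨hf, C₁, hC₁, ρ₁, hρ₁, h₁⟩ := hf
  obtain ⟨hg, C₂, hC₂, ρ₂, hρ₂, h₂⟩ := hg
  refine ⟨hf.add hg, C₁ + C₂, by positivity, max ρ₁ ρ₂, by positivity, fun x => ?_⟩
  exact ((h₁ x).mono hC₁.le hρ₁.le le_rfl (le_max_left _ _)).add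
    ((h₂ x).mono hC₂.le hρ₂.le le_rfl (le_max_right _ _)) hf hg

theorem clm_comp (L : F →L[ℝ] G) {f : E → F} (hf : UniformlyGevrey s f) :
    UniformlyGevrey s fun x => L (f x) := by
  obtain ⟨hf, C, hC, ρ, hρ, h⟩ := hf
  refine ⟨L.contDiff.comp hf, (‖L‖ + 1) * C, by positivity, ρ, hρ, fun x => ?_⟩
  exact ((h x).clm_comp L hf).mono (by positivity) hρ.le (by gcongr; linarith) le_rfl

theorem mul {f g : E → ℝ} (hs : 0 ≤ s) (hf : UniformlyGevrey s f) (hg : UniformlyGevrey s g) :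
    UniformlyGevrey s fun x => f x * g x := by
  obtain ⟨hf, C₁, hC₁, ρ₁, hρ₁, h₁⟩ := hf
  obtain ⟨hg, C₂, hC₂, ρ₂, hρ₂, h₂⟩ := hg
  exact ⟨hf.mul hg, C₁ * C₂, by positivity, ρ₁ + ρ₂, by positivity, fun x =>
    (h₁ x).mul hs (h₂ x) hC₁.le hC₂.le hρ₁.le hρ₂.le hf hg⟩

theorem tsum [CompleteSpace F] {ι : Type*} {f : ι → E → F} (hf : ∀ i, ContDiff ℝ (⊤ : ℕ∞) (f i))
    {u : ι → ℝ}
    (hu : Summable u) (hu0 : ∀ i, 0 ≤ u i) {ρ : ℝ} (hρ : 0 < ρ)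
    (h : ∀ i x, GevreyBoundAt s (u i) ρ (f i) x) : UniformlyGevrey s fun x => ∑' i, f i x := by
  have hsum : ∀ k : ℕ, (k : ℕ∞) ≤ (⊤ : ℕ∞) → Summable fun i => u i * ρ ^ k * (k ! : ℝ) ^ s :=
    fun k _ => (hu.mul_right _).mul_right _
  refine ⟨contDiff_tsum hf hsum fun k i x _ => h i x k, ∑' i, u i + 1,
    add_pos_of_nonneg_of_pos (tsum_nonneg hu0) one_pos, ρ, hρ, fun x k => ?_⟩
  rw [iteratedFDeriv_tsum_apply hf hsum (fun k i x _ => h i x k) le_top]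
  have h1 := tsum_of_norm_bounded (hsum k le_top).hasSum fun i => h i x k
  rw [tsum_mul_right, tsum_mul_right] at h1
  refine h1.trans ?_
  gcongr
  linarith

theorem comp_clm (L : G →L[ℝ] E) {f : E → F} (hf : UniformlyGevrey s f) :
    UniformlyGevrey s fun y => f (L y) := by
  obtain ⟨hs, C, hC, ρ, hρ, hb⟩ := hf
  refine ⟨hs.comp L.contDiff, C, hC, ρ * (‖L‖ + 1), by positivity, fun y => ?_⟩
  exact ((hb (L y)).comp_clm L hs).mono hC.le (by positivity) le_rfl
    (by gcongr; linarith)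

theorem sum {ι : Type*} (t : Finset ι) {f : ι → E → F} (hf : ∀ i, UniformlyGevrey s (f i)) :
    UniformlyGevrey s fun x => ∑ i ∈ t, f i x := by
  classical
  induction t using Finset.induction_on with
  | empty => exact ⟨by simpa using contDiff_const, 1, one_pos, 1, one_pos, fun x => by
      simpa using GevreyBoundAt.zero s 1 1 zero_le_one zero_le_one x⟩
  | insert i t hi ih => simpa only [Finset.sum_insert hi] using (hf i).add ih

end UniformlyGevrey

variable {n p : ℕ}

theorem exists_local_gevrey_factor (hn : 1 ≤ n) {δ : ℝ} (hδ : 0 < δ)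
    {f : (Fin p → Fin n → ℝ) → ℝ} (hf : ContDiff ℝ (⊤ : ℕ∞) f)
    (hfG : ∀ K : Set (Fin p → Fin n → ℝ), IsCompact K →
      ∃ C > (0 : ℝ), ∃ ρ > (0 : ℝ), ∀ x ∈ K, GevreyBoundAt (1 + δ) C ρ f x)
    (hinv : ∀ π : Fin p → Equiv.Perm (Fin n), ∀ x : Fin p → Fin n → ℝ,
      f (fun j i => x j (π j i)) = f x)
    {R : ℝ} (hR : 0 ≤ R) :
    ∃ F : (Fin p → Fin n → ℝ) → ℝ, UniformlyGevrey (1 + n * δ) F ∧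
      ∀ x, ‖x‖ ≤ R → f x = F (theta n p x) := by
  obtain ⟨Λ, hΛ, c, A, hA, κ, hκ, hc1, hc2⟩ := exists_exp_expansion hδ hf hfG hR
  obtain ⟨C, hC, ρ, hρ, h⟩ := exists_gevrey_symmExp_extension p hn hδ hΛ (half_pos hκ) R
  have hη : ∀ ξ : Fin p × Fin n → ℤ, ‖fun j i => Λ * (ξ (j, i) : ℝ)‖ ≤ Λ * max 1 ‖ξ‖ := fun ξ => by
    refine (pi_norm_le_iff_of_nonneg (by positivity)).2 fun j =>
      (pi_norm_le_iff_of_nonneg (by positivity)).2 fun i => ?_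
    rw [norm_mul, Real.norm_of_nonneg hΛ.le, Int.norm_cast_real]
    gcongr
    exact (norm_le_pi_norm ξ (j, i)).trans (le_max_right _ _)
  choose ψ hψ1 hψ2 hψ3 using fun ξ : Fin p × Fin n → ℤ => h _ (le_max_left 1 ‖ξ‖) _ (hη ξ)
  have hb : ∀ ξ a, GevreyBoundAt (1 + n * δ)
      (A * C * Real.exp (-(κ / 2 * max 1 ‖ξ‖ ^ (1 / (1 + δ))))) ρ
      (fun a => (ContinuousLinearMap.mul ℝ ℂ (c ξ)) (ψ ξ a)) a := fun ξ a => by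
    refine ((hψ3 ξ a).clm_comp _ (hψ1 ξ)).mono (by positivity) hρ.le ?_ le_rfl
    rw [ContinuousLinearMap.opNorm_mul_apply]
    calc _ ≤ _ := mul_le_mul_of_nonneg_right (hc1 ξ) (by positivity)
      _ = A * C * (Real.exp (-(κ * max 1 ‖ξ‖ ^ (1 / (1 + δ)))) *
            Real.exp (κ / 2 * max 1 ‖ξ‖ ^ (1 / (1 + δ)))) := by ring
      _ = _ := by rw [← Real.exp_add]; ring_nf
  have hF := UniformlyGevrey.tsum
    (fun ξ => (ContinuousLinearMap.contDiff _).comp (hψ1 ξ))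
    ((summable_exp_neg_mul_rpow (half_pos hκ) (by positivity : 0 < 1 / (1 + δ))).mul_left (A * C))
    (fun ξ => by positivity) hρ hb
  refine ⟨_, hF.clm_comp Complex.reCLM, fun x hx => ?_⟩
  have := (hasSum_prod_symmExp hinv hR hc2 hx).tsum_eq
  change f x = Complex.re (∑' ξ, c ξ * ψ ξ (theta n p x))
  simp only [hψ2 _ x hx]
  rw [this, Complex.ofReal_re]

theorem exists_uniformlyGevrey_bump (n p : ℕ) {s : ℝ} (hs : 1 < s) (R : ℝ) :
    ∃ χ : (Fin p → Fin n → ℝ) → ℝ, UniformlyGevrey s χ ∧ (∀ x, ‖x‖ ≤ R → χ x = 1) ∧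
      ∀ x, R + 1 ≤ ‖x‖ → χ x = 0 := by
  have hs' : 0 < s - 1 := by linarith
  obtain ⟨C, hC, ρ, hρ, hχ⟩ := exists_gevrey_cutoff n p (α := 1 / (s - 1)) one_pos (by positivity)
  obtain ⟨χ, hχ1, hχ2, hχ3, hχ4⟩ := hχ (1 / 2) (by norm_num) (by norm_num) (Metric.closedBall 0 R)
  rw [one_div_one_div, add_sub_cancel] at hχ4
  refine ⟨χ, ⟨hχ1, _, by positivity, ρ, hρ, hχ4⟩, fun x hx => hχ2 x (mem_closedBall_zero_iff.2 hx),
    fun x hx => hχ3 x fun a ha => ?_⟩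
  rw [mem_closedBall_zero_iff] at ha
  have := norm_sub_norm_le x a
  rw [dist_eq_norm]; linarith

theorem exists_glue_uniformlyGevrey {s : ℝ} (hs : 1 < s) {X : Type*}
    {θ : X → Fin p → Fin n → ℝ} {f : X → ℝ}
    (h : ∀ R : ℝ, 0 ≤ R → ∃ F : (Fin p → Fin n → ℝ) → ℝ, UniformlyGevrey s F ∧
      ∀ x, ‖θ x‖ ≤ R → f x = F (θ x)) :
    ∃ F : (Fin p → Fin n → ℝ) → ℝ, ContDiff ℝ (⊤ : ℕ∞) F ∧
      (∀ K : Set (Fin p → Fin n → ℝ), IsCompact K →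
        ∃ C > (0 : ℝ), ∃ ρ > (0 : ℝ), ∀ x ∈ K, GevreyBoundAt s C ρ F x) ∧
      ∀ x, f x = F (θ x) := by
  let P : ℕ → ((Fin p → Fin n → ℝ) → ℝ) → Prop := fun ν F =>
    UniformlyGevrey s F ∧ ∀ x, ‖θ x‖ ≤ ν + 1 → f x = F (θ x)
  have step : ∀ ν F, P ν F → ∃ F', P (ν + 1) F' ∧ ∀ a, ‖a‖ ≤ ν → F' a = F a := by
    rintro ν F ⟨hF1, hF2⟩
    obtain ⟨H, hH1, hH2⟩ := h (ν + 2) (by positivity)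
    obtain ⟨χ, hχ1, hχ2, hχ3⟩ := exists_uniformlyGevrey_bump n p hs ν
    refine ⟨fun a => H a + χ a * (F a + (-ContinuousLinearMap.id ℝ ℝ) (H a)),
      ⟨hH1.add (hχ1.mul (by linarith) (hF1.add (hH1.clm_comp _))), fun x hx => ?_⟩, fun a ha => ?_⟩
    · have e1 := hH2 x (hx.trans (by push_cast; linarith))
      by_cases hx' : ‖θ x‖ ≤ ν + 1
      · simp [← hF2 x hx', ← e1]
      · push Not at hx'
        simp [hχ3 _ hx'.le, ← e1]
    · simp [hχ2 a ha]
  obtain ⟨F₀, hF₀⟩ : ∃ F, P 0 F := by simpa [P] using h 1 zero_le_one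
  choose! next hnext1 hnext2 using step
  let F : ℕ → (Fin p → Fin n → ℝ) → ℝ := fun ν => Nat.rec F₀ next ν
  have hF : ∀ ν, P ν (F ν) := fun ν => by
    induction ν with
    | zero => exact hF₀
    | succ ν ih => exact hnext1 ν _ ih
  have hF' : ∀ (μ ν : ℕ) a, ‖a‖ ≤ μ → F (μ + ν) a = F μ a := fun μ ν a ha => by
    induction ν with
    | zero => rfl
    | succ ν ih =>
      rw [← ih]
      exact hnext2 (μ + ν) _ (hF _) a (ha.trans (by push_cast; linarith [(Nat.cast_nonneg ν :
          (0 : ℝ) ≤ ν)]))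
  let G : (Fin p → Fin n → ℝ) → ℝ := fun a => F ⌈‖a‖⌉₊ a
  have hG : ∀ (ν : ℕ) a, ‖a‖ ≤ ν → G a = F ν a := fun ν a ha => by
    obtain ⟨m, rfl⟩ := Nat.exists_eq_add_of_le (Nat.ceil_le.2 ha)
    exact (hF' _ m a (Nat.le_ceil _)).symm
  have hGe : ∀ (ν : ℕ) a, ‖a‖ < ν → F ν =ᶠ[nhds a] G := fun ν a ha => by
    filter_upwards [continuous_norm.continuousAt.eventually_lt_const ha] with y hy
    exact (hG ν y hy.le).symm
  refine ⟨G, contDiff_iff_contDiffAt.2 fun a => ?_, fun K hK => ?_, fun x => ?_⟩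
  · obtain ⟨ν, hν⟩ := exists_nat_gt ‖a‖
    exact (hF ν).1.1.contDiffAt.congr_of_eventuallyEq (hGe ν a hν).symm
  · obtain ⟨r, hr⟩ := hK.isBounded.exists_norm_le
    obtain ⟨ν, hν⟩ := exists_nat_gt r
    obtain ⟨-, C, hC, ρ, hρ, hb⟩ := (hF ν).1
    exact ⟨C, hC, ρ, hρ, fun x hx => (hb x).congr (hGe ν x ((hr x hx).trans_lt hν))⟩
  · rw [hG _ _ (Nat.le_ceil _)]
    exact (hF _).2 x ((Nat.le_ceil _).trans (by linarith))

theorem norm_le_of_norm_theta_le {R : ℝ} (hR : 0 ≤ R) {x : Fin p → Fin n → ℝ}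
    (hx : ‖theta n p x‖ ≤ R) : ‖x‖ ≤ 1 + n * R := by
  rw [← norm_ofRealPi_apply]
  refine (pi_norm_le_iff_of_nonneg (by positivity)).2 fun j =>
    (norm_le_of_esymmVec (ofRealPi n p x j)).trans ?_
  have h : ‖thetaC (ofRealPi n p x) j‖ ≤ R := by
    rw [← ofRealPi_theta]
    exact (norm_le_pi_norm _ j).trans ((norm_ofRealPi_apply _ _ _).le.trans hx)
  gcongr
  exact h

theorem exists_gevrey_factor (hn : 1 ≤ n) {δ : ℝ} (hδ : 0 < δ) {f : (Fin p → Fin n → ℝ) → ℝ}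
    (hf : CMClassOn (fun k => (k ! : ℝ) ^ δ) Set.univ f)
    (hinv : ∀ π : Fin p → Equiv.Perm (Fin n), ∀ x : Fin p → Fin n → ℝ,
      f (fun j i => x j (π j i)) = f x) :
    ∃ F : (Fin p → Fin n → ℝ) → ℝ, CMClassOn (fun k => (k ! : ℝ) ^ (δ * (n : ℝ))) Set.univ F ∧
      ∀ x, f x = F (theta n p x) := by
  rw [cmClassOn_univ_iff] at hf
  have hn0 : (0 : ℝ) < n := by exact_mod_cast hn
  obtain ⟨F, hF1, hF2, hF3⟩ := exists_glue_uniformlyGevrey (s := 1 + n * δ) (θ := theta n p)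
      (f := f)
    (by have : 0 < n * δ := by positivity
        linarith) fun R hR => by
    obtain ⟨F, hF1, hF2⟩ := exists_local_gevrey_factor hn hδ hf.1 hf.2 hinv (R := 1 + n * R)
      (by positivity)
    exact ⟨F, hF1, fun x hx => hF2 x (norm_le_of_norm_theta_le hR hx)⟩
  refine ⟨F, (cmClassOn_univ_iff F).2 ⟨hF1, ?_⟩, hF3⟩
  rwa [mul_comm δ]

end Gluing

theorem pow_mul_rpow_mul_exp_neg_le {α : ℝ} (hα : 0 < α) {u : ℝ} (hu : 0 ≤ u) (k : ℕ) :
    (u ^ α) ^ k * Real.exp (-u) ≤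
      Real.exp (-(u / 2)) * (((2 * α)⁻¹)⁻¹ ^ α) ^ k * (k ! : ℝ) ^ α := by
  have h := pow_le_factorial_mul_exp (η := (2 * α)⁻¹) (by positivity) hu k
  have h2 := Real.rpow_le_rpow (by positivity) h hα.le
  rw [Real.mul_rpow (by positivity) (by positivity), Real.mul_rpow (by positivity) (by positivity),
    ← Real.exp_mul, ← Real.rpow_natCast, ← Real.rpow_mul hu, mul_comm, Real.rpow_mul hu,
    Real.rpow_natCast, ← Real.rpow_natCast (_ : ℝ)⁻¹, ← Real.rpow_mul (by positivity),
    mul_comm (k : ℝ) α, Real.rpow_mul (by positivity), Real.rpow_natCast] at h2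
  have h3 : (2 * α)⁻¹ * u * α = u / 2 := by field_simp
  rw [h3] at h2
  calc _ ≤ (k ! : ℝ) ^ α * (((2 * α)⁻¹)⁻¹ ^ α) ^ k * Real.exp (u / 2) * Real.exp (-u) := by gcongr
    _ = (k ! : ℝ) ^ α * (((2 * α)⁻¹)⁻¹ ^ α) ^ k * (Real.exp (u / 2) * Real.exp (-u)) := by ring
    _ = _ := by
      rw [← Real.exp_add]; ring_nf

theorem iteratedDeriv_const_mul_cos (c a : ℝ) (k : ℕ) (x : ℝ) :
    iteratedDeriv k (fun t => c * Real.cos (a * t)) x =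
      c * (a ^ k * iteratedDeriv k Real.cos (a * x)) := by
  rw [iteratedDeriv_const_mul c (by fun_prop), iteratedDeriv_comp_const_mul Real.contDiff_cos]

/-- A function of Gevrey order `α` whose even derivatives at `0` are as large as that order
permits. -/
theorem exists_uniformlyGevrey_le_iteratedDeriv {α : ℝ} (hα : 0 < α) :
    ∃ h : ℝ → ℝ, UniformlyGevrey α h ∧
      ∀ k : ℕ, Real.exp (-((2 * k : ℕ) : ℝ)) * ((2 * k)! : ℝ) ^ α ≤
        |iteratedDeriv (2 * k) h 0| := by
  set f : ℕ → ℝ → ℝ := fun m t => Real.exp (-(m : ℝ)) * Real.cos ((m : ℝ) ^ α * t) with hf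
  set ρ : ℝ := ((2 * α)⁻¹)⁻¹ ^ α
  have hfd : ∀ i, ContDiff ℝ (⊤ : ℕ∞) (f i) := fun i => by
    simp only [hf]; fun_prop
  have hu : Summable fun m : ℕ => Real.exp (-((m : ℝ) / 2)) := by
    have := Real.summable_exp_nat_mul_iff.mpr (show (-(1 / 2 : ℝ)) < 0 by norm_num)
    refine this.congr fun m => ?_
    ring_nf
  have hb : ∀ (i : ℕ) (x : ℝ), GevreyBoundAt α (Real.exp (-((i : ℝ) / 2))) ρ (f i)
      x := fun i x k => by
    rw [norm_iteratedFDeriv_eq_norm_iteratedDeriv, iteratedDeriv_const_mul_cos, norm_mul, norm_mul,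
      norm_pow, Real.norm_of_nonneg (by positivity), Real.norm_of_nonneg (by positivity)]
    refine le_trans ?_ (pow_mul_rpow_mul_exp_neg_le hα (Nat.cast_nonneg i) k)
    have := Real.abs_iteratedDeriv_cos_le_one k ((i : ℝ) ^ α * x)
    rw [Real.norm_eq_abs, mul_comm]
    gcongr
    exact mul_le_of_le_one_right (by positivity) this
  refine ⟨fun t => ∑' m, f m t, UniformlyGevrey.tsum hfd hu (fun i => by positivity)
    (by positivity) hb, fun k => ?_⟩
  have hval : ∀ m : ℕ, iteratedDeriv (2 * k) (f m) 0 =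
      (-1) ^ k * (Real.exp (-(m : ℝ)) * ((m : ℝ) ^ α) ^ (2 * k)) := fun m => by
    rw [iteratedDeriv_const_mul_cos, Real.iteratedDeriv_even_cos]
    simp; ring
  have hD : iteratedDeriv (2 * k) (fun t => ∑' m, f m t) 0 =
      ∑' m, iteratedDeriv (2 * k) (f m) 0 := by
    have hv : ∀ k : ℕ, (k : ℕ∞) ≤ ⊤ →
        Summable fun m : ℕ => Real.exp (-((m : ℝ) / 2)) * ρ ^ k * (k ! : ℝ) ^ α :=
      fun k _ => (hu.mul_right _).mul_right _
    simp only [iteratedDeriv]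
    rw [iteratedFDeriv_tsum_apply hfd hv (fun k i x _ => hb i x k) le_top]
    exact (ContinuousMultilinearMap.apply ℝ _ ℝ fun _ => (1 : ℝ)).map_tsum
      (Summable.of_norm_bounded (hv (2 * k) le_top) fun i => hb i 0 (2 * k))
  have hsum : Summable fun m : ℕ => Real.exp (-(m : ℝ)) * ((m : ℝ) ^ α) ^ (2 * k) := by
    refine Summable.of_nonneg_of_le (fun m => by positivity) (fun m => ?_)
      ((hu.mul_right (ρ ^ (2 * k))).mul_right (((2 * k)! : ℝ) ^ α))
    rw [mul_comm]
    exact pow_mul_rpow_mul_exp_neg_le hα (Nat.cast_nonneg m) (2 * k)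
  rw [hD, tsum_congr hval, tsum_mul_left, abs_mul, abs_pow, abs_neg, abs_one, one_pow, one_mul]
  refine le_trans ?_ (le_abs_self _)
  refine le_trans ?_ (hsum.le_tsum (2 * k) fun m _ => by positivity)
  refine mul_le_mul_of_nonneg_left ?_ (by positivity)
  rw [← Real.rpow_natCast, ← Real.rpow_mul (by positivity), mul_comm α,
      Real.rpow_mul (by positivity),
    Real.rpow_natCast]
  refine Real.rpow_le_rpow (by positivity) ?_ hα.le
  exact_mod_cast Nat.factorial_le_pow _

section TaylorComparison

theorem taylor_isBigO {V : Type*} [NormedAddCommGroup V] [NormedSpace ℝ V]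
    [FiniteDimensional ℝ V] {f : V → ℝ} (hf : ContDiff ℝ (⊤ : ℕ∞) f) (N : ℕ) :
    (fun y : V => f y - ∑ k ∈ Finset.range (N + 1),
        (k ! : ℝ)⁻¹ * iteratedFDeriv ℝ k f 0 fun _ => y) =O[nhds 0] fun y => ‖y‖ ^ (N + 1) := by
  have hcont : Continuous fun y => ‖iteratedFDeriv ℝ (N + 1) f y‖ :=
    (hf.continuous_iteratedFDeriv (m := N + 1) (by exact_mod_cast le_top)).norm
  obtain ⟨M, hM⟩ := (isCompact_closedBall (0 : V) 1).exists_bound_of_continuousOn hcont.continuousOn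
  refine Asymptotics.IsBigO.of_bound ((N ! : ℝ)⁻¹ * M) ?_
  filter_upwards [Metric.closedBall_mem_nhds (0 : V) one_pos] with y hy
  have hT := map_add_eq_sum_add_integral_iteratedFDeriv (f := f) (x := 0) (y := y) (n := N)
    fun t _ => (hf.of_le (by exact_mod_cast le_top)).contDiffAt
  simp only [zero_add, smul_eq_mul] at hT
  rw [hT, add_sub_cancel_left, norm_mul, Real.norm_of_nonneg (by positivity), mul_assoc]
  gcongr
  have := intervalIntegral.norm_integral_le_of_norm_le_const (a := (0 : ℝ)) (b := 1)
    (f := fun t => (1 - t) ^ N * iteratedFDeriv ℝ (N + 1) f (t • y) fun _ => y)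
    (C := M * ‖y‖ ^ (N + 1)) fun t ht => ?_
  · simpa using this
  · rw [Set.uIoc_of_le zero_le_one] at ht
    have h1 : ‖(1 - t) ^ N‖ ≤ 1 := by
      rw [norm_pow, Real.norm_of_nonneg (by linarith [ht.2])]
      exact pow_le_one₀ (by linarith [ht.2]) (by linarith [ht.1])
    have h2 : t • y ∈ Metric.closedBall (0 : V) 1 := by
      simp only [mem_closedBall_zero_iff] at hy ⊢
      rw [norm_smul, Real.norm_of_nonneg ht.1.le]
      exact mul_le_one₀ ht.2 (norm_nonneg _) hy
    have h3 := (iteratedFDeriv ℝ (N + 1) f (t • y)).le_opNorm fun _ => y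
    have h4 := hM _ h2
    rw [norm_norm] at h4
    simp only [Finset.prod_const, Finset.card_univ, Fintype.card_fin] at h3
    calc _ ≤ 1 * (M * ‖y‖ ^ (N + 1)) := by
          rw [norm_mul]
          gcongr
          exact h3.trans (by gcongr)
      _ = _ := one_mul _

theorem Polynomial.coeff_eq_zero_of_eval_isBigO {N : ℕ} {p : Polynomial ℝ}
    (hp : (fun t => p.eval t) =O[nhdsWithin 0 {0}ᶜ] fun t => t ^ N) {m : ℕ} (hm : m < N) :
    p.coeff m = 0 := by
  induction N generalizing p m with
  | zero => omega
  | succ N ih =>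
    have h0 : p.coeff 0 = 0 := by
      have h1 : Filter.Tendsto (fun t => p.eval t) (nhdsWithin 0 {0}ᶜ) (nhds 0) := by
        refine hp.trans_tendsto ?_
        have : Continuous fun t : ℝ => t ^ (N + 1) := by fun_prop
        simpa using (this.tendsto 0).mono_left nhdsWithin_le_nhds
      have h2 := (p.continuous.tendsto 0).mono_left (nhdsWithin_le_nhds (s := {0}ᶜ))
      rw [Polynomial.coeff_zero_eq_eval_zero]
      exact tendsto_nhds_unique h2 h1
    have hX : ∀ t, p.eval t = t * p.divX.eval t := fun t => by
      conv_lhs => rw [← p.X_mul_divX_add, h0]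
      simp
    cases m with
    | zero => exact h0
    | succ m =>
      rw [← Polynomial.coeff_divX]
      refine ih ?_ (by omega)
      obtain ⟨c, hc⟩ := hp.bound
      refine Asymptotics.IsBigO.of_bound c ?_
      filter_upwards [hc, self_mem_nhdsWithin] with t ht ht0
      have ht0' : 0 < ‖t‖ := norm_pos_iff.mpr ht0
      rw [hX, norm_mul, pow_succ, norm_mul] at ht
      refine le_of_mul_le_mul_left ?_ ht0'
      linarith

theorem ContinuousMultilinearMap.apply_eq_sum_single {n l : ℕ}
    (A : ContinuousMultilinearMap ℝ (fun _ : Fin l => Fin n → ℝ) ℝ) (y : Fin n → ℝ) :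
    (A fun _ => y) = ∑ r : Fin l → Fin n, (∏ a, y (r a)) * A fun a => Pi.single (r a) 1 := by
  have hy : y = ∑ i, y i • (Pi.single i 1 : Fin n → ℝ) := by
    ext j; simp [Finset.sum_apply, Pi.single_apply]
  conv_lhs => rw [hy]
  rw [A.map_sum]
  exact Finset.sum_congr rfl fun r _ => by rw [A.map_smul_univ, smul_eq_mul]

theorem esymmVec_smul {n : ℕ} (t : ℝ) (x : Fin n → ℝ) (i : Fin n) :
    esymmVec (t • x) i = t ^ (i.1 + 1) * esymmVec x i := by
  simp only [esymmVec, Pi.smul_apply, smul_eq_mul, Finset.mul_sum]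
  refine Finset.sum_congr rfl fun s hs => ?_
  rw [Finset.prod_mul_distrib, Finset.prod_const, (Finset.mem_powersetCard.mp hs).2]

/-- Comparing the homogeneous parts of degree `N` of the Taylor series at the origin of both sides
of `Φ (σ x) = ∑ i, h (x i)`. -/
theorem taylor_coeff_comparison {n : ℕ} {Φ : (Fin n → ℝ) → ℝ} {h : ℝ → ℝ}
    (hΦ : ContDiff ℝ (⊤ : ℕ∞) Φ) (hh : ContDiff ℝ (⊤ : ℕ∞) h)
    (heq : ∀ x, Φ (esymmVec x) = ∑ i, h (x i)) (N : ℕ) (x : Fin n → ℝ) :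
    ∑ l ∈ Finset.range (N + 1), ∑ r : Fin l → Fin n,
      (if N = ∑ a, ((r a).1 + 1) then
        ((l ! : ℝ)⁻¹ * iteratedFDeriv ℝ l Φ 0 fun a => Pi.single (r a) 1) *
          ∏ a, esymmVec x (r a) else 0) =
    (N ! : ℝ)⁻¹ * iteratedDeriv N h 0 * ∑ i, x i ^ N := by
  set P : Polynomial ℝ := ∑ l ∈ Finset.range (N + 1), ∑ r : Fin l → Fin n,
    Polynomial.C (((l ! : ℝ)⁻¹ * iteratedFDeriv ℝ l Φ 0 fun a => Pi.single (r a) 1) *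
          ∏ a, esymmVec x (r a)) * Polynomial.X ^ (∑ a, ((r a).1 + 1)) with hP
  set Q : Polynomial ℝ := ∑ m ∈ Finset.range (N + 1),
    Polynomial.C ((m ! : ℝ)⁻¹ * iteratedDeriv m h 0 * ∑ i, x i ^ m) * Polynomial.X ^ m with hQ
  have hPe : ∀ t, P.eval t = ∑ l ∈ Finset.range (N + 1),
      (l ! : ℝ)⁻¹ * iteratedFDeriv ℝ l Φ 0 fun _ => esymmVec (t • x) := fun t => by
    rw [hP, Polynomial.eval_finsetSum]
    refine Finset.sum_congr rfl fun l _ => ?_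
    rw [ContinuousMultilinearMap.apply_eq_sum_single, Polynomial.eval_finsetSum, Finset.mul_sum]
    refine Finset.sum_congr rfl fun r _ => ?_
    simp only [Polynomial.eval_mul, Polynomial.eval_C, Polynomial.eval_pow, Polynomial.eval_X,
      esymmVec_smul, Finset.prod_mul_distrib, Finset.prod_pow_eq_pow_sum]
    ring
  have hQe : ∀ t, Q.eval t = ∑ i, ∑ m ∈ Finset.range (N + 1),
      (m ! : ℝ)⁻¹ * iteratedFDeriv ℝ m h 0 fun _ => t * x i := fun t => by
    rw [hQ, Polynomial.eval_finsetSum, Finset.sum_comm]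
    refine Finset.sum_congr rfl fun m _ => ?_
    simp only [Polynomial.eval_mul, Polynomial.eval_C, Polynomial.eval_pow, Polynomial.eval_X,
      iteratedFDeriv_apply_eq_iteratedDeriv_mul_prod, Finset.prod_const, Finset.card_univ,
      Fintype.card_fin, mul_pow, Finset.mul_sum, Finset.sum_mul, smul_eq_mul]
    exact Finset.sum_congr rfl fun i _ => by ring
  have hlin : ∀ i, Filter.Tendsto (fun t : ℝ => t * x i) (nhds 0) (nhds 0) := fun i => by
    have : Continuous fun t : ℝ => t * x i := by fun_prop
    simpa using this.tendsto 0
  have hes : Filter.Tendsto (fun t : ℝ => esymmVec (t • x)) (nhds 0) (nhds 0) := by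
    rw [tendsto_pi_nhds]
    intro i
    simp only [esymmVec_smul]
    have : Continuous fun t : ℝ => t ^ (i.1 + 1) * esymmVec x i := by fun_prop
    simpa using this.tendsto 0
  have hesO : (fun t : ℝ => esymmVec (t • x)) =O[nhds 0] fun t : ℝ => t := by
    rw [Asymptotics.isBigO_pi]
    intro i
    have hc : Continuous fun t : ℝ => t ^ i.1 * esymmVec x i := by fun_prop
    have hm := (Asymptotics.isBigO_refl (fun t : ℝ => t) (nhds 0)).mul
      ((hc.tendsto 0).isBigO_one ℝ)
    refine hm.congr (fun t => ?_) fun t => mul_one t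
    rw [esymmVec_smul]; ring
  have h1 := ((taylor_isBigO hΦ N).comp_tendsto hes).trans (hesO.norm_left.pow (N + 1))
  have h2 := Asymptotics.IsBigO.sum (s := Finset.univ) fun i _ =>
    ((taylor_isBigO hh N).comp_tendsto (hlin i)).trans
      (((Asymptotics.isBigO_refl (fun t : ℝ => t) (nhds 0)).const_mul_left (x i)).norm_left.pow
        (N + 1) |>.congr_left fun t => by simp [mul_comm])
  have h3 : (fun t => (P - Q).eval t) =O[nhds 0] fun t : ℝ => t ^ (N + 1) := by
    refine (h2.sub h1).congr_left fun t => ?_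
    have := heq (t • x)
    simp only [Pi.smul_apply, smul_eq_mul] at this
    simp only [Finset.sum_apply, Function.comp_apply, Finset.sum_sub_distrib,
        Polynomial.eval_sub, hPe, hQe, this]
    ring
  have h4 := Polynomial.coeff_eq_zero_of_eval_isBigO (h3.mono nhdsWithin_le_nhds) N.lt_succ_self
  rw [Polynomial.coeff_sub, sub_eq_zero, hP, hQ] at h4
  simp only [Polynomial.finsetSum_coeff, Polynomial.coeff_C_mul_X_pow] at h4
  rw [h4, Finset.sum_ite_eq, if_pos (Finset.self_mem_range_succ N)]

/-- If `Φ ∘ σ = ∑ i, h (x i)`, the even pure derivatives of `Φ` at the origin in the last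
coordinate direction are, up to factorials, derivatives of `h`. -/
theorem iteratedFDeriv_single_last_eq {n : ℕ} (hn : n - 1 < n) {Φ : (Fin n → ℝ) → ℝ} {h : ℝ → ℝ}
    (hΦ : ContDiff ℝ (⊤ : ℕ∞) Φ) (hh : ContDiff ℝ (⊤ : ℕ∞) h)
    (heq : ∀ x, Φ (esymmVec x) = ∑ i, h (x i)) (k : ℕ) :
    (((2 * k)! : ℕ) : ℝ)⁻¹ * (iteratedFDeriv ℝ (2 * k) Φ 0 fun _ => Pi.single ⟨n - 1, hn⟩ 1) =
      (((n * (2 * k))! : ℕ) : ℝ)⁻¹ * iteratedDeriv (n * (2 * k)) h 0 * n := by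
  set N := n * (2 * k) with hN
  set b : (l : ℕ) → (Fin l → Fin n) → ℝ := fun l r =>
    (l ! : ℝ)⁻¹ * iteratedFDeriv ℝ l Φ 0 fun a => Pi.single (r a) 1 with hb
  set c : ℝ := (N ! : ℝ)⁻¹ * iteratedDeriv N h 0 with hc
  have hpoly : (∑ l ∈ Finset.range (N + 1), ∑ r : Fin l → Fin n,
      (if N = ∑ a, ((r a).1 + 1) then MvPolynomial.C (b l r) *
          ∏ a, esymmVec (fun i => (MvPolynomial.X i : MvPolynomial (Fin n) ℝ)) (r a) else 0)) =
      MvPolynomial.C c * ∑ i, MvPolynomial.X i ^ N := by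
    refine MvPolynomial.funext fun x => ?_
    have := taylor_coeff_comparison hΦ hh heq N x
    simp only [esymmVec] at this
    simpa [esymmVec, apply_ite] using this
  obtain ⟨z, hz⟩ := esymmVec_surjective (n := n) (Pi.single ⟨n - 1, hn⟩ 1)
  have hzn : ∀ i, z i ^ n = -(-1) ^ n := fun i => by
    have h1 := prod_sub_eq z (z i)
    rw [Finset.prod_eq_zero (Finset.mem_univ i) (sub_self _), hz,
      Finset.sum_eq_single ⟨n - 1, hn⟩ (fun j _ hj => by simp [hj]) (by simp)] at h1
    have h2 : n - 1 + 1 = n := by omega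
    simp only [h2, Pi.single_eq_same, Nat.sub_self, pow_zero, mul_one] at h1
    linear_combination -h1
  have hzN : ∀ i, z i ^ N = 1 := fun i => by
    rw [hN, pow_mul, hzn, pow_mul, neg_sq, pow_right_comm _ n 2]
    simp
  have hev := congrArg (MvPolynomial.aeval z) hpoly
  have hes : ∀ i, MvPolynomial.aeval z
      (esymmVec (fun i => (MvPolynomial.X i : MvPolynomial (Fin n) ℝ)) i) =
        (Pi.single ⟨n - 1, hn⟩ 1 : Fin n → ℂ) i := fun i => by
    rw [← hz]; simp [esymmVec]
  simp only [map_sum, apply_ite (MvPolynomial.aeval z), map_mul, map_prod, hes, map_zero, map_pow,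
    MvPolynomial.aeval_X, MvPolynomial.aeval_C, hzN] at hev
  have hzero : ∀ (l : ℕ) (r : Fin l → Fin n), (r ≠ fun _ => ⟨n - 1, hn⟩) →
      ∏ a, (Pi.single ⟨n - 1, hn⟩ 1 : Fin n → ℂ) (r a) = 0 := fun l r hr => by
    obtain ⟨a, ha⟩ := Function.ne_iff.mp hr
    exact Finset.prod_eq_zero (Finset.mem_univ a) (by simp [ha])
  have h2 : n - 1 + 1 = n := by omega
  have hinner : ∀ l, (∑ r : Fin l → Fin n, if N = ∑ a, ((r a).1 + 1) then
      (algebraMap ℝ ℂ) (b l r) * ∏ a, (Pi.single ⟨n - 1, hn⟩ 1 : Fin n → ℂ) (r a) else 0) =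
      if l = 2 * k then (algebraMap ℝ ℂ) (b l fun _ => ⟨n - 1, hn⟩) else 0 := fun l => by
    rw [Finset.sum_eq_single (fun _ => ⟨n - 1, hn⟩) (fun r _ hr => by simp [hzero l r hr])
      (by simp)]
    have h3 : (N = ∑ _a : Fin l, (n - 1 + 1)) ↔ l = 2 * k := by
      rw [h2, Finset.sum_const, Finset.card_univ, Fintype.card_fin, smul_eq_mul, hN, mul_comm]
      constructor
      · intro h; exact (Nat.eq_of_mul_eq_mul_right (by omega) h).symm
      · rintro rfl; rfl
    simp only [h3]
    simp
  simp only [hinner] at hev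
  rw [Finset.sum_ite_eq', if_pos] at hev
  · have : b (2 * k) (fun _ => ⟨n - 1, hn⟩) = c * n := by
      apply_fun (algebraMap ℝ ℂ) using (algebraMap ℝ ℂ).injective
      rw [hev]; simp
    exact this
  · rw [Finset.mem_range, hN]
    nlinarith

end TaylorComparison

section Sharpness

theorem exists_mul_pow_lt_factorial_rpow {C B ε : ℝ} (hC : 0 < C) (hB : 0 < B) (hε : 0 < ε) :
    ∃ k : ℕ, C * B ^ (2 * k) < ((2 * k)! : ℝ) ^ ε := by
  have h := (FloorSemiring.tendsto_pow_div_factorial_atTop (B ^ ε⁻¹)).const_mul (C ^ ε⁻¹)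
  rw [mul_zero] at h
  obtain ⟨k, hk⟩ := Filter.eventually_atTop.mp (h.eventually_lt_const one_pos)
  refine ⟨k, ?_⟩
  have h1 := hk (2 * k) (by omega)
  rw [← mul_div_assoc, div_lt_one (by positivity)] at h1
  have h2 := Real.rpow_lt_rpow (by positivity) h1 hε
  rwa [Real.mul_rpow (by positivity) (by positivity), Real.rpow_inv_rpow hC.le hε.ne',
    ← Real.rpow_natCast, ← Real.rpow_mul hB.le, ← Real.rpow_mul hB.le, mul_right_comm,
    inv_mul_cancel₀ hε.ne', one_mul, Real.rpow_natCast] at h2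

theorem factorial_pow_le_factorial_mul (n m : ℕ) : m ! ^ n ≤ (n * m)! := by
  have := Nat.prod_factorial_dvd_factorial_sum (Finset.range n) fun _ => m
  simp only [Finset.prod_const, Finset.sum_const, Finset.card_range, smul_eq_mul] at this
  exact Nat.le_of_dvd (Nat.factorial_pos _) this

theorem esymmVec_zero (n : ℕ) : esymmVec (0 : Fin n → ℝ) = 0 := by
  ext i
  simpa using esymmVec_smul 0 (0 : Fin n → ℝ) i

theorem not_exists_gevrey_factor {n p : ℕ} (hn : 1 ≤ n) {δ γ : ℝ} (hγ : γ < δ * n) {h : ℝ → ℝ}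
    (hδ : 0 < δ) (hh : ContDiff ℝ (⊤ : ℕ∞) h)
    (hlow : ∀ k : ℕ, Real.exp (-((2 * k : ℕ) : ℝ)) * ((2 * k)! : ℝ) ^ (1 + δ) ≤
        |iteratedDeriv (2 * k) h 0|) (j : Fin p) :
    ¬∃ F : (Fin p → Fin n → ℝ) → ℝ, CMClassOn (fun k => (k ! : ℝ) ^ γ) Set.univ F ∧
      ∀ x, ∑ i, h (x j i) = F (theta n p x) := by
  rintro ⟨F, hF, hfac⟩
  obtain ⟨hFs, hFb⟩ := (cmClassOn_univ_iff F).mp hF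
  set ι := ContinuousLinearMap.single ℝ (fun _ : Fin p => Fin n → ℝ) j
  obtain ⟨C, hC, ρ, hρ, hb⟩ := hFb {ι 0} isCompact_singleton
  have hΦb := (hb _ rfl).comp_clm ι hFs
  have hn' : n - 1 < n := by omega
  have heq : ∀ x : Fin n → ℝ, F (ι (esymmVec x)) = ∑ i, h (x i) := fun x => by
    have h1 := hfac (ι x)
    have h2 : theta n p (ι x) = ι (esymmVec x) := by
      ext j' i
      change esymmVec (ι x j') i = _
      by_cases hj : j' = j
      · subst hj; simp [ι]
      · simp [ι, hj, esymmVec_zero]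
    rw [← h2, ← h1]
    simp [ι]
  have hB : 0 < (ρ * (‖ι‖ + 1)) * Real.exp n := by positivity
  obtain ⟨k, hk⟩ := exists_mul_pow_lt_factorial_rpow hC hB (sub_pos.mpr hγ)
  have hkey := iteratedFDeriv_single_last_eq hn' (hFs.comp ι.contDiff) hh heq k
  have hnk : n * (2 * k) = 2 * (n * k) := by ring
  have hl := hlow (n * k)
  rw [← hnk] at hl
  set m := 2 * k
  set D := iteratedFDeriv ℝ m (F ∘ ι) 0
  have hD : |D fun _ => Pi.single ⟨n - 1, hn'⟩ 1| ≤
      C * (ρ * (‖ι‖ + 1)) ^ m * (m ! : ℝ) ^ (1 + γ) := by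
    have h1 := D.le_opNorm fun _ => Pi.single ⟨n - 1, hn'⟩ 1
    simp only [Pi.norm_single, norm_one, Finset.prod_const_one, mul_one] at h1
    refine h1.trans ((hΦb m).trans ?_)
    gcongr
    linarith
  have hm : (0 : ℝ) < m ! := by positivity
  have hN : (0 : ℝ) < (n * m)! := by positivity
  have hkey' : (n : ℝ) * |iteratedDeriv (n * m) h 0| =
      ((n * m)! : ℝ) * ((m ! : ℝ)⁻¹ * |D fun _ => Pi.single ⟨n - 1, hn'⟩ 1|) := by
    have := congrArg abs hkey
    rw [abs_mul, abs_mul, abs_mul, abs_of_pos (inv_pos.mpr hm), abs_of_pos (inv_pos.mpr hN),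
      Nat.abs_cast] at this
    rw [this]; field_simp
  have h1 : Real.exp (-((n * m : ℕ) : ℝ)) * ((n * m)! : ℝ) ^ (1 + δ) ≤
      ((n * m)! : ℝ) * ((m ! : ℝ)⁻¹ * (C * (ρ * (‖ι‖ + 1)) ^ m * (m ! : ℝ) ^ (1 + γ))) := by
    refine hl.trans ?_
    refine (le_mul_of_one_le_left (abs_nonneg _) (by exact_mod_cast hn : (1 : ℝ) ≤ n)).trans ?_
    rw [hkey']
    gcongr
  rw [Real.rpow_one_add' hN.le (by positivity), Real.rpow_add hm, Real.rpow_one] at h1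
  have h2 : Real.exp (-((n * m : ℕ) : ℝ)) * ((n * m)! : ℝ) ^ δ ≤
      C * (ρ * (‖ι‖ + 1)) ^ m * (m ! : ℝ) ^ γ := by
    refine le_of_mul_le_mul_left ?_ hN
    calc _ = _ := by ring
      _ ≤ _ := h1
      _ = _ := by field_simp
  have h3 : (m ! : ℝ) ^ (δ * n) ≤ ((n * m)! : ℝ) ^ δ := by
    rw [mul_comm, Real.rpow_mul hm.le, Real.rpow_natCast]
    refine Real.rpow_le_rpow (by positivity) ?_ hδ.le
    exact_mod_cast factorial_pow_le_factorial_mul n m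
  have h4 : Real.exp (-((n * m : ℕ) : ℝ)) * Real.exp n ^ m = 1 := by
    rw [← Real.exp_nat_mul, ← Real.exp_add]
    push_cast; ring_nf; simp
  rw [Real.rpow_sub hm, lt_div_iff₀ (by positivity), mul_pow] at hk
  have h5 := (mul_le_mul_of_nonneg_left h3 (Real.exp_nonneg (-((n * m : ℕ) : ℝ)))).trans h2
  have h6 := mul_lt_mul_of_pos_left hk (Real.exp_pos (-((n * m : ℕ) : ℝ)))
  have h7 : Real.exp (-((n * m : ℕ) : ℝ)) *
      (C * ((ρ * (‖ι‖ + 1)) ^ m * Real.exp n ^ m) * (m ! : ℝ) ^ γ) =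
      C * (ρ * (‖ι‖ + 1)) ^ m * (m ! : ℝ) ^ γ := by
    linear_combination (C * (ρ * (‖ι‖ + 1)) ^ m * (m ! : ℝ) ^ γ) * h4
  linarith

end Sharpness

theorem exists_symmetric_gevrey_not_factor {n p : ℕ} (hn : 1 ≤ n) (hp : 1 ≤ p) {δ γ : ℝ}
    (hδ : 0 < δ) (hγ : γ < δ * n) :
    ∃ f : (Fin p → Fin n → ℝ) → ℝ, CMClassOn (fun k => (k ! : ℝ) ^ δ) Set.univ f ∧
      (∀ π : Fin p → Equiv.Perm (Fin n), ∀ x : Fin p → Fin n → ℝ,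
        f (fun j i => x j (π j i)) = f x) ∧
      ¬∃ F : (Fin p → Fin n → ℝ) → ℝ,
          CMClassOn (fun k => (k ! : ℝ) ^ γ) Set.univ F ∧ ∀ x, f x = F (theta n p x) := by
  obtain ⟨h, hh, hlow⟩ :=
    exists_uniformlyGevrey_le_iteratedDeriv (show 0 < 1 + δ by linarith)
  set j : Fin p := ⟨0, hp⟩
  refine ⟨fun x => ∑ i, h (x j i), (cmClassOn_univ_iff _).mpr ?_,
    fun π x => Equiv.sum_comp (π j) fun i => h (x j i),
    not_exists_gevrey_factor hn hγ hδ hh.1 hlow j⟩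
  obtain ⟨hs, C, hC, ρ, hρ, hb⟩ := UniformlyGevrey.sum Finset.univ fun i : Fin n =>
    hh.comp_clm ((ContinuousLinearMap.proj i : (Fin n → ℝ) →L[ℝ] ℝ).comp
      (ContinuousLinearMap.proj j : (Fin p → Fin n → ℝ) →L[ℝ] (Fin n → ℝ)))
  exact ⟨hs, fun K _ => ⟨C, hC, ρ, hρ, fun x _ => hb x⟩⟩

/-- For `n, p ≥ 1` and `δ > 0`, every `S_n × ⋯ × S_n`-invariant Gevrey
function `f ∈ G^{1+δ}((ℝⁿ)^p)` has the form `f = F ∘ θ` with `F ∈ G^{1+δn}((ℝⁿ)^p)`,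
and the exponent `δn` is minimal possible. -/
theorem symmetric_Gevrey_functions_minimal_exponent
    (n p : ℕ) (hn : 1 ≤ n) (hp : 1 ≤ p) (δ : ℝ) (hδ : 0 < δ) :
    (∀ f : (Fin p → Fin n → ℝ) → ℝ,
        CMClassOn (fun k => (k ! : ℝ) ^ δ) Set.univ f →
        (∀ π : Fin p → Equiv.Perm (Fin n), ∀ x : Fin p → Fin n → ℝ,
          f (fun j i => x j (π j i)) = f x) →
        ∃ F : (Fin p → Fin n → ℝ) → ℝ,
          CMClassOn (fun k => (k ! : ℝ) ^ (δ * (n : ℝ))) Set.univ F ∧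
          ∀ x, f x = F (theta n p x)) ∧
      ∀ γ : ℝ, 0 < γ → γ < δ * (n : ℝ) →
        ∃ f : (Fin p → Fin n → ℝ) → ℝ,
          CMClassOn (fun k => (k ! : ℝ) ^ δ) Set.univ f ∧
          (∀ π : Fin p → Equiv.Perm (Fin n), ∀ x : Fin p → Fin n → ℝ,
            f (fun j i => x j (π j i)) = f x) ∧
          ¬∃ F : (Fin p → Fin n → ℝ) → ℝ,
              CMClassOn (fun k => (k ! : ℝ) ^ γ) Set.univ F ∧
              ∀ x, f x = F (theta n p x) :=
  ⟨fun _ hf hinv => exists_gevrey_factor hn hδ hf hinv, fun _ _ hγ =>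
    exists_symmetric_gevrey_not_factor hn hp hδ hγ⟩
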